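/- Let f be a nonconstant real analytic function on 𝕋^b and fix λ ∈ ℝ and E ∈ ℝ. Then the Lyapunov exponent ω ↦ γ(E,ω) of the quasiperiodic Schrödinger cocycle is continuous at every incommensurate ω ∈ 𝕋^b. -/

import Mathlib

open MeasureTheory Filter

noncomputable section

/-- The Frobenius norm of a 2×2 real matrix. -/
def matNorm (M : Matrix (Fin 2) (Fin 2) ℝ) : ℝ := Real.sqrt (∑ i, ∑ j, (M i j) ^ 2)

/-- The `k`-step transfer matrix `M_k(θ,E,ω) = ∏_{n=k-1}^{0} A(θ + nω, E)` of the quasiperiodic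
Schrödinger cocycle with potential `λ f`, where `A(θ,E) = [[E - λ f(θ), -1],[1,0]]`. -/
def transfer (b : ℕ) (f : (Fin b → ℝ) → ℝ) (lam E : ℝ) (ω θ : Fin b → ℝ) :
    ℕ → Matrix (Fin 2) (Fin 2) ℝ
  | 0 => 1
  | (k + 1) => !![E - lam * f (θ + (k : ℝ) • ω), -1; 1, 0] * transfer b f lam E ω θ k

/-- `γ` is the Lyapunov exponent at energy `E` and frequency `ω`:
`γ = lim_{k→∞} (1/k) ∫_{𝕋^b} log ‖M_k(θ,E,ω)‖ dθ`. -/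
def HasLyapunov (b : ℕ) (f : (Fin b → ℝ) → ℝ) (lam E : ℝ) (ω : Fin b → ℝ) (γ : ℝ) : Prop :=
  Tendsto (fun k : ℕ => (1 / (k : ℝ)) *
      ∫ θ in Set.Icc (0 : Fin b → ℝ) 1, Real.log (matNorm (transfer b f lam E ω θ k)))
    atTop (nhds γ)

/-- `ω ∈ 𝕋^b` is incommensurate: `n ⬝ ω ∉ ℤ` for every nonzero integer vector `n`. -/
def Incommensurate (b : ℕ) (ω : Fin b → ℝ) : Prop :=
  ∀ n : Fin b → ℤ, n ≠ 0 → ∀ m : ℤ, (∑ i, (n i : ℝ) * ω i) ≠ (m : ℝ)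

/-- The squared Frobenius norm of a 2×2 matrix. -/
def sqNorm {𝕜 : Type*} [RCLike 𝕜] (M : Matrix (Fin 2) (Fin 2) 𝕜) : ℝ := ∑ i, ∑ j, ‖M i j‖ ^ 2

/-- The one-step Schrödinger matrix. -/
def stepMat {𝕜 : Type*} [RCLike 𝕜] (x : 𝕜) : Matrix (Fin 2) (Fin 2) 𝕜 := !![x, -1; 1, 0]

/-- The product of the first `k` one-step matrices of a sequence. -/
def cocycle {𝕜 : Type*} [RCLike 𝕜] (a : ℕ → 𝕜) : ℕ → Matrix (Fin 2) (Fin 2) 𝕜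
  | 0 => 1
  | (k + 1) => stepMat (a k) * cocycle a k

section MatrixFacts

variable {𝕜 : Type*} [RCLike 𝕜]

lemma sqNorm_eq (M : Matrix (Fin 2) (Fin 2) 𝕜) :
    sqNorm M = ‖M 0 0‖ ^ 2 + ‖M 0 1‖ ^ 2 + ‖M 1 0‖ ^ 2 + ‖M 1 1‖ ^ 2 := by
  simp only [sqNorm, Fin.sum_univ_two]; ring

lemma sqNorm_nonneg (M : Matrix (Fin 2) (Fin 2) 𝕜) : 0 ≤ sqNorm M := by
  unfold sqNorm; positivity

lemma norm_mul_add_mul_sq_le (a b c d : 𝕜) :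
    ‖a * c + b * d‖ ^ 2 ≤ (‖a‖ ^ 2 + ‖b‖ ^ 2) * (‖c‖ ^ 2 + ‖d‖ ^ 2) := by
  have h : ‖a * c + b * d‖ ≤ ‖a‖ * ‖c‖ + ‖b‖ * ‖d‖ :=
    (norm_add_le _ _).trans (by rw [norm_mul, norm_mul])
  calc ‖a * c + b * d‖ ^ 2 ≤ (‖a‖ * ‖c‖ + ‖b‖ * ‖d‖) ^ 2 := by gcongr
    _ ≤ _ := by nlinarith [sq_nonneg (‖a‖ * ‖d‖ - ‖b‖ * ‖c‖)]

lemma sqNorm_mul_le (A B : Matrix (Fin 2) (Fin 2) 𝕜) : sqNorm (A * B) ≤ sqNorm A * sqNorm B := by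
  simp only [sqNorm_eq, Matrix.mul_apply, Fin.sum_univ_two]
  have h00 := norm_mul_add_mul_sq_le (A 0 0) (A 0 1) (B 0 0) (B 1 0)
  have h01 := norm_mul_add_mul_sq_le (A 0 0) (A 0 1) (B 0 1) (B 1 1)
  have h10 := norm_mul_add_mul_sq_le (A 1 0) (A 1 1) (B 0 0) (B 1 0)
  have h11 := norm_mul_add_mul_sq_le (A 1 0) (A 1 1) (B 0 1) (B 1 1)
  linarith

lemma two_le_sqNorm {A : Matrix (Fin 2) (Fin 2) 𝕜} (hA : A.det = 1) : 2 ≤ sqNorm A := by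
  rw [Matrix.det_fin_two] at hA
  have h : (1 : ℝ) ≤ ‖A 0 0‖ * ‖A 1 1‖ + ‖A 0 1‖ * ‖A 1 0‖ := by
    calc (1 : ℝ) = ‖A 0 0 * A 1 1 - A 0 1 * A 1 0‖ := by rw [hA]; simp
      _ ≤ _ := (norm_sub_le _ _).trans (by rw [norm_mul, norm_mul])
  rw [sqNorm_eq]
  nlinarith [sq_nonneg (‖A 0 0‖ - ‖A 1 1‖), sq_nonneg (‖A 0 1‖ - ‖A 1 0‖)]

lemma sqNorm_stepMat (x : 𝕜) : sqNorm (stepMat x) = ‖x‖ ^ 2 + 2 := by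
  simp [sqNorm_eq, stepMat]; ring

lemma det_stepMat (x : 𝕜) : (stepMat x).det = 1 := by
  simp [stepMat, Matrix.det_fin_two]

lemma det_cocycle (a : ℕ → 𝕜) (k : ℕ) : (cocycle a k).det = 1 := by
  induction k with
  | zero => simp [cocycle]
  | succ k ih => simp [cocycle, Matrix.det_mul, ih, det_stepMat]

lemma sqNorm_adjugate (A : Matrix (Fin 2) (Fin 2) 𝕜) : sqNorm A.adjugate = sqNorm A := by
  simp [sqNorm_eq, Matrix.adjugate_fin_two]; ring

lemma cocycle_add (a : ℕ → 𝕜) (j k : ℕ) :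
    cocycle a (k + j) = cocycle (fun n => a (k + n)) j * cocycle a k := by
  induction j with
  | zero => simp [cocycle]
  | succ j ih => rw [← add_assoc, cocycle, ih, cocycle, Matrix.mul_assoc]

lemma norm_add_sq_le_two (x y : 𝕜) : ‖x + y‖ ^ 2 ≤ 2 * ‖x‖ ^ 2 + 2 * ‖y‖ ^ 2 := by
  have h : ‖x + y‖ ^ 2 ≤ (‖x‖ + ‖y‖) ^ 2 := by gcongr; exact norm_add_le _ _
  nlinarith [sq_nonneg (‖x‖ - ‖y‖)]

/-- The complementary minors of a product of three matrices. -/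
lemma sqNorm_mul_sqNorm_le (A B C : Matrix (Fin 2) (Fin 2) 𝕜) (hB : B.det = 1) :
    sqNorm (C * B) * sqNorm (B * A) ≤
      2 * (sqNorm B * sqNorm (C * B * A)) + 2 * (sqNorm C * sqNorm A) := by
  have key : ∀ i j k l : Fin 2, ‖(C * B) i j * (B * A) k l‖ ^ 2 ≤
      2 * (‖B k j‖ ^ 2 * ‖(C * B * A) i l‖ ^ 2) +
      2 * (‖C i (Equiv.swap 0 1 k)‖ ^ 2 * ‖A (Equiv.swap 0 1 j) l‖ ^ 2) := by
    intro i j k l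
    have hdet : B 0 0 * B 1 1 - B 0 1 * B 1 0 = 1 := by rw [← Matrix.det_fin_two]; exact hB
    obtain ⟨σ, hσ, h⟩ : ∃ σ : 𝕜, ‖σ‖ = 1 ∧ (C * B) i j * (B * A) k l =
        B k j * (C * B * A) i l + σ * (C i (Equiv.swap 0 1 k) * A (Equiv.swap 0 1 j) l) := by
      simp only [Matrix.mul_apply, Fin.sum_univ_two]
      fin_cases j <;> fin_cases k <;>
        simp only [Fin.zero_eta, Fin.mk_one, Equiv.swap_apply_left, Equiv.swap_apply_right,
          Fin.isValue]
      · exact ⟨-1, by simp, by linear_combination (-C i 1 * A 1 l) * hdet⟩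
      · exact ⟨1, by simp, by linear_combination (C i 0 * A 1 l) * hdet⟩
      · exact ⟨1, by simp, by linear_combination (C i 1 * A 0 l) * hdet⟩
      · exact ⟨-1, by simp, by linear_combination (-C i 0 * A 0 l) * hdet⟩
    rw [h]
    refine (norm_add_sq_le_two _ _).trans_eq ?_
    simp only [norm_mul, hσ]; ring
  have hsum := Finset.sum_le_sum fun i (_ : i ∈ (Finset.univ : Finset (Fin 2))) =>
    Finset.sum_le_sum fun j (_ : j ∈ (Finset.univ : Finset (Fin 2))) =>
    Finset.sum_le_sum fun k (_ : k ∈ (Finset.univ : Finset (Fin 2))) =>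
    Finset.sum_le_sum fun l (_ : l ∈ (Finset.univ : Finset (Fin 2))) => key i j k l
  simp only [Fin.sum_univ_two, norm_mul, mul_pow, Equiv.swap_apply_left,
    Equiv.swap_apply_right] at hsum
  simp only [sqNorm_eq]
  linarith

end MatrixFacts

/-- The logarithm of the Frobenius norm of the `k`-step product. -/
def logNorm {𝕜 : Type*} [RCLike 𝕜] (a : ℕ → 𝕜) (k : ℕ) : ℝ := Real.log (sqNorm (cocycle a k)) / 2

section LogNorm

variable {𝕜 : Type*} [RCLike 𝕜]

lemma sqNorm_cocycle_pos (a : ℕ → 𝕜) (k : ℕ) : 0 < sqNorm (cocycle a k) :=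
  two_pos.trans_le (two_le_sqNorm (det_cocycle a k))

lemma logNorm_nonneg (a : ℕ → 𝕜) (k : ℕ) : 0 ≤ logNorm a k :=
  div_nonneg (Real.log_nonneg (one_le_two.trans (two_le_sqNorm (det_cocycle a k)))) two_pos.le

lemma logNorm_add_le (a : ℕ → 𝕜) (k j : ℕ) :
    logNorm a (k + j) ≤ logNorm (fun n => a (k + n)) j + logNorm a k := by
  unfold logNorm
  rw [← add_div, ← Real.log_mul (sqNorm_cocycle_pos _ _).ne' (sqNorm_cocycle_pos _ _).ne',
    cocycle_add]
  gcongr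
  · rw [← cocycle_add]; exact sqNorm_cocycle_pos _ _
  · exact sqNorm_mul_le _ _

lemma log_sqNorm_stepMat_le {x : 𝕜} {M : ℝ} (hx : ‖x‖ ≤ M) :
    Real.log (sqNorm (stepMat x)) / 2 ≤ Real.log (M ^ 2 + 2) / 2 := by
  rw [sqNorm_stepMat]; gcongr

lemma logNorm_le {a : ℕ → 𝕜} {M : ℝ} (ha : ∀ n, ‖a n‖ ≤ M) {k : ℕ} (hk : 1 ≤ k) :
    logNorm a k ≤ k * (Real.log (M ^ 2 + 2) / 2) := by
  induction k, hk using Nat.le_induction with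
  | base =>
    simpa [logNorm, cocycle] using log_sqNorm_stepMat_le (ha 0)
  | succ k hk ih =>
    refine (logNorm_add_le a k 1).trans ?_
    have : logNorm (fun n => a (k + n)) 1 ≤ Real.log (M ^ 2 + 2) / 2 := by
      simpa [logNorm, cocycle] using log_sqNorm_stepMat_le (ha k)
    push_cast
    linarith

lemma cocycle_shift (a : ℕ → 𝕜) (k : ℕ) :
    cocycle (fun n => a (n + 1)) k * stepMat (a 0) = stepMat (a k) * cocycle a k := by
  have h := cocycle_add a k 1
  simp only [cocycle, mul_one] at h
  simpa only [add_comm 1, cocycle] using h.symm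

lemma abs_logNorm_shift_sub_le {a : ℕ → 𝕜} {M : ℝ} (ha : ∀ n, ‖a n‖ ≤ M) (k : ℕ) :
    |logNorm (fun n => a (n + 1)) k - logNorm a k| ≤ 2 * (Real.log (M ^ 2 + 2) / 2) := by
  set T := cocycle a k
  set T' := cocycle (fun n => a (n + 1)) k
  have hT : 0 < sqNorm T := sqNorm_cocycle_pos _ _
  have hT' : 0 < sqNorm T' := sqNorm_cocycle_pos _ _
  have hpos : ∀ x : 𝕜, 0 < sqNorm (stepMat x) := fun x => by rw [sqNorm_stepMat]; positivity
  have hinv : ∀ x : 𝕜, stepMat x * (stepMat x).adjugate = 1 := fun x => by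
    rw [Matrix.mul_adjugate, det_stepMat, one_smul]
  have hinv' : ∀ x : 𝕜, (stepMat x).adjugate * stepMat x = 1 := fun x => by
    rw [Matrix.adjugate_mul, det_stepMat, one_smul]
  have hs : T' * stepMat (a 0) = stepMat (a k) * T := cocycle_shift a k
  have h1 : T' = stepMat (a k) * T * (stepMat (a 0)).adjugate := by
    rw [← hs, Matrix.mul_assoc, hinv, Matrix.mul_one]
  have h2 : T = (stepMat (a k)).adjugate * (T' * stepMat (a 0)) := by
    rw [hs, ← Matrix.mul_assoc, hinv', Matrix.one_mul]
  have b1 : sqNorm T' ≤ sqNorm (stepMat (a k)) * sqNorm T * sqNorm (stepMat (a 0)) := by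
    conv_lhs => rw [h1]
    refine (sqNorm_mul_le _ _).trans ?_
    rw [sqNorm_adjugate]
    exact mul_le_mul_of_nonneg_right (sqNorm_mul_le _ _) (sqNorm_nonneg _)
  have b2 : sqNorm T ≤ sqNorm (stepMat (a k)) * (sqNorm T' * sqNorm (stepMat (a 0))) := by
    conv_lhs => rw [h2]
    refine (sqNorm_mul_le _ _).trans ?_
    rw [sqNorm_adjugate]
    exact mul_le_mul_of_nonneg_left (sqNorm_mul_le _ _) (sqNorm_nonneg _)
  have l1 := Real.log_le_log hT' b1
  have l2 := Real.log_le_log hT b2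
  rw [Real.log_mul (mul_pos (hpos _) hT).ne' (hpos _).ne', Real.log_mul (hpos _).ne' hT.ne'] at l1
  rw [Real.log_mul (hpos _).ne' (mul_pos hT' (hpos _)).ne', Real.log_mul hT'.ne' (hpos _).ne'] at l2
  have c1 := log_sqNorm_stepMat_le (ha 0)
  have c2 := log_sqNorm_stepMat_le (ha k)
  change |Real.log (sqNorm T') / 2 - Real.log (sqNorm T) / 2| ≤ _
  rw [abs_le]
  constructor <;> linarith

lemma abs_logNorm_shift_sub_le_mul {a : ℕ → 𝕜} {M : ℝ} (ha : ∀ n, ‖a n‖ ≤ M) (k l : ℕ) :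
    |logNorm (fun n => a (n + l)) k - logNorm a k| ≤ l * (2 * (Real.log (M ^ 2 + 2) / 2)) := by
  induction l with
  | zero => simp
  | succ l ih =>
    have h := abs_logNorm_shift_sub_le (a := fun n => a (n + l)) (fun n => ha _) k
    have e : (fun n => a (n + 1 + l)) = fun n => a (n + (l + 1)) := by
      funext n; congr 1; ring
    simp only [e] at h
    have := abs_sub_le (logNorm (fun n => a (n + (l + 1))) k) (logNorm (fun n => a (n + l)) k)
      (logNorm a k)
    push_cast
    linarith

/-- If the overlapping products `CB` and `BA` are large compared with `C` and `A`, then the norm of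
`CBA` is almost multiplicative. -/
lemma log_sqNorm_three_le {A B C : Matrix (Fin 2) (Fin 2) 𝕜} (hA : A.det = 1) (hB : B.det = 1)
    (hC : C.det = 1)
    (h : Real.log (sqNorm C) + Real.log (sqNorm A) + 2 * Real.log 2 ≤
      Real.log (sqNorm (C * B)) + Real.log (sqNorm (B * A))) :
    Real.log (sqNorm (C * B)) + Real.log (sqNorm (B * A)) ≤
      Real.log (sqNorm (C * B * A)) + Real.log (sqNorm B) + 2 * Real.log 2 := by
  have pos : ∀ {X : Matrix (Fin 2) (Fin 2) 𝕜}, X.det = 1 → 0 < sqNorm X :=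
    fun hX => two_pos.trans_le (two_le_sqNorm hX)
  have pA := pos hA
  have pB := pos hB
  have pC := pos hC
  have pCB : 0 < sqNorm (C * B) := pos (by rw [Matrix.det_mul, hB, hC, mul_one])
  have pBA : 0 < sqNorm (B * A) := pos (by rw [Matrix.det_mul, hB, hA, mul_one])
  have pCBA : 0 < sqNorm (C * B * A) := pos (by simp [Matrix.det_mul, hA, hB, hC])
  have e4 : 2 * Real.log 2 = Real.log 4 := by
    rw [show (4 : ℝ) = 2 ^ 2 by norm_num, Real.log_pow]; norm_num
  rw [e4] at h ⊢
  rw [← Real.log_mul pC.ne' pA.ne', ← Real.log_mul (mul_pos pC pA).ne' (by norm_num),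
    ← Real.log_mul pCB.ne' pBA.ne',
    Real.log_le_log_iff (by positivity) (by positivity)] at h
  rw [← Real.log_mul pCBA.ne' pB.ne', ← Real.log_mul (mul_pos pCBA pB).ne' (by norm_num),
    ← Real.log_mul pCB.ne' pBA.ne',
    Real.log_le_log_iff (by positivity) (by positivity)]
  have := sqNorm_mul_sqNorm_le A B C hB
  linarith

/-- Almost multiplicativity for four consecutive blocks of equal length. -/
lemma logNorm_four_blocks_le (a : ℕ → 𝕜) (K : ℕ) (p q : ℕ → ℝ)
    (hp : ∀ j, p j = logNorm (fun n => a (j * K + n)) K)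
    (hq : ∀ j, q j = logNorm (fun n => a (j * K + n)) (2 * K))
    (h1 : p 3 + p 1 + Real.log 2 ≤ q 2 + q 1)
    (h2 : p 2 + p 0 + 2 * Real.log 2 ≤ q 1 + q 0) :
    q 2 + q 1 + q 0 - p 2 - p 1 - 2 * Real.log 2 ≤ logNorm a (4 * K) := by
  set X : ℕ → Matrix (Fin 2) (Fin 2) 𝕜 := fun j => cocycle (fun n => a (j * K + n)) K with hX
  have dX : ∀ j, (X j).det = 1 := fun j => det_cocycle _ _
  have hp' : ∀ j, p j = Real.log (sqNorm (X j)) / 2 := hp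
  have hq' : ∀ j, q j = Real.log (sqNorm (X (j + 1) * X j)) / 2 := by
    intro j
    rw [hq, logNorm, two_mul, cocycle_add]
    simp only [hX, ← add_assoc, add_mul, one_mul]
  have h4 : logNorm a (4 * K) = Real.log (sqNorm (X 3 * X 2 * X 1 * X 0)) / 2 := by
    rw [logNorm, show 4 * K = K + K + K + K by ring, cocycle_add, cocycle_add, cocycle_add]
    simp only [hX, Matrix.mul_assoc, zero_mul, zero_add, one_mul]
    rw [show 3 * K = K + K + K by ring, show 2 * K = K + K by ring]
  rw [hp', hp', hq', hq'] at h1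
  rw [hp', hp', hq', hq'] at h2
  rw [hp', hp', hq', hq', hq', h4]
  norm_num at h1 h2 ⊢
  have s1 := log_sqNorm_three_le (dX 1) (dX 2) (dX 3) (by linarith)
  have s2 := log_sqNorm_three_le (A := X 0) (B := X 1) (C := X 3 * X 2) (dX 0) (dX 1)
    (by rw [Matrix.det_mul, dX, dX, mul_one]) (by linarith)
  linarith

end LogNorm

lemma transfer_eq_cocycle (b : ℕ) (f : (Fin b → ℝ) → ℝ) (lam E : ℝ) (ω θ : Fin b → ℝ) (k : ℕ) :
    transfer b f lam E ω θ k = cocycle (fun n => E - lam * f (θ + (n : ℝ) • ω)) k := by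
  induction k with
  | zero => rfl
  | succ k ih => rw [transfer, cocycle, ih, stepMat]

lemma log_matNorm_transfer (b : ℕ) (f : (Fin b → ℝ) → ℝ) (lam E : ℝ) (ω θ : Fin b → ℝ) (k : ℕ) :
    Real.log (matNorm (transfer b f lam E ω θ k)) =
      logNorm (fun n => E - lam * f (θ + (n : ℝ) • ω)) k := by
  rw [transfer_eq_cocycle, matNorm, Real.log_sqrt (by positivity), logNorm, sqNorm]
  simp

/-- Lebesgue measure on the unit cube, which represents Haar measure of the torus. -/
def cubeMeasure (b : ℕ) : Measure (Fin b → ℝ) := volume.restrict (Set.Icc 0 1)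

instance (b : ℕ) : IsProbabilityMeasure (cubeMeasure b) := by
  constructor
  rw [cubeMeasure, Measure.restrict_apply_univ, Real.volume_Icc_pi]
  simp

/-- The vector of `ℝ^b` with the given integer coordinates. -/
def intVec {b : ℕ} (m : Fin b → ℤ) : Fin b → ℝ := fun i => (m i : ℝ)

/-- Periodicity with respect to the integer lattice. -/
def LatticePeriodic {b : ℕ} {X : Type*} (g : (Fin b → ℝ) → X) : Prop :=
  ∀ (m : Fin b → ℤ) (x : Fin b → ℝ), g (x + intVec m) = g x

section Torus

variable {b : ℕ} {X : Type*}

lemma exists_intVec_add_mem_Icc (x : Fin b → ℝ) :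
    ∃ m : Fin b → ℤ, x + intVec m ∈ Set.Icc (0 : Fin b → ℝ) 1 := by
  refine ⟨fun i => -⌊x i⌋, fun i => ?_, fun i => ?_⟩
  · simp [intVec, Int.floor_le]
  · simpa [intVec, add_comm] using (Int.lt_floor_add_one (x i)).le

lemma intVec_neg (m : Fin b → ℤ) : intVec (-m) = -intVec m := by
  funext i; simp [intVec]

lemma LatticePeriodic.comp {Y : Type*} {g : (Fin b → ℝ) → X} (hg : LatticePeriodic g) (φ : X → Y) :
    LatticePeriodic fun x => φ (g x) :=
  fun m x => congrArg φ (hg m x)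

lemma LatticePeriodic.comp_add {g : (Fin b → ℝ) → X} (hg : LatticePeriodic g) (v : Fin b → ℝ) :
    LatticePeriodic fun x => g (x + v) := fun m x => by
  change g (x + intVec m + v) = g (x + v)
  rw [add_right_comm, hg]

lemma LatticePeriodic.exists_norm_le {E : Type*} [NormedAddCommGroup E] {g : (Fin b → ℝ) → E}
    (hg : LatticePeriodic g) (hc : Continuous g) : ∃ C, ∀ x, ‖g x‖ ≤ C := by
  obtain ⟨C, hC⟩ := (isCompact_Icc (a := (0 : Fin b → ℝ)) (b := 1)).exists_bound_of_continuousOn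
    hc.continuousOn
  refine ⟨C, fun x => ?_⟩
  obtain ⟨m, hm⟩ := exists_intVec_add_mem_Icc x
  rw [← hg m x]
  exact hC _ hm

lemma LatticePeriodic.integral_add {E : Type*} [NormedAddCommGroup E] [NormedSpace ℝ E]
    {g : (Fin b → ℝ) → E} (hg : LatticePeriodic g) (v : Fin b → ℝ) :
    ∫ x, g (x + v) ∂cubeMeasure b = ∫ x, g x ∂cubeMeasure b := by
  set D := ZSpan.fundamentalDomain (Pi.basisFun ℝ (Fin b)) with hD
  have hcube : ∀ F : (Fin b → ℝ) → E, ∫ x, F x ∂cubeMeasure b = ∫ x in D, F x := by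
    intro F
    rw [cubeMeasure, hD, ZSpan.fundamentalDomain_pi_basisFun]
    exact (setIntegral_congr_set Measure.univ_pi_Ico_ae_eq_Icc).symm
  have hfd := ZSpan.isAddFundamentalDomain' (Pi.basisFun ℝ (Fin b)) volume
  have hfd' : IsAddFundamentalDomain (Submodule.span ℤ (Set.range (Pi.basisFun ℝ (Fin b)))).toAddSubgroup
      ((fun x => x + v) ⁻¹' D) (volume : Measure (Fin b → ℝ)) := by
    have := hfd.preimage_of_equiv (measurePreserving_add_right volume v).quasiMeasurePreserving
      (f := fun x => x + v) (e := id) Function.bijective_id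
      (fun g x => by simp only [id, AddSubgroup.vadd_def, vadd_eq_add, add_assoc])
    exact this
  have hinv : ∀ (u : (Submodule.span ℤ (Set.range (Pi.basisFun ℝ (Fin b)))).toAddSubgroup) (x : Fin b → ℝ),
      g ((u +ᵥ x) + v) = g (x + v) := by
    intro u x
    have hu := ((Pi.basisFun ℝ (Fin b)).mem_span_iff_repr_mem ℤ _).mp u.2
    choose m hm using hu
    have : (u : Fin b → ℝ) = intVec m := by
      funext i; simpa [intVec] using (hm i).symm
    rw [AddSubgroup.vadd_def, vadd_eq_add, this, add_comm (intVec m)]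
    exact hg.comp_add v m x
  have : Countable (Submodule.span ℤ (Set.range (Pi.basisFun ℝ (Fin b)))).toAddSubgroup :=
    inferInstanceAs (Countable (Submodule.span ℤ (Set.range (Pi.basisFun ℝ (Fin b)))))
  rw [hcube, hcube, hfd.setIntegral_eq hfd' hinv]
  exact (measurePreserving_add_right volume v).setIntegral_preimage_emb
    (measurableEmbedding_addRight v) g D

lemma Continuous.integrable_cube {E : Type*} [NormedAddCommGroup E] {g : (Fin b → ℝ) → E}
    (hg : Continuous g) : Integrable g (cubeMeasure b) :=
  (hg.continuousOn.integrableOn_compact isCompact_Icc : IntegrableOn g (Set.Icc 0 1) volume)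

end Torus

section ComplexExtension

open scoped NNReal ENNReal Topology Nat

variable {V : Type*} [NormedAddCommGroup V] [NormedSpace ℝ V]

/-- The `n`-th Taylor coefficient at `0` of `t ↦ f (x + t • e)`. -/
def taylorCoeff (f : V → ℝ) (x e : V) (n : ℕ) : ℝ :=
  (n ! : ℝ)⁻¹ * iteratedFDeriv ℝ n f x fun _ => e

lemma iteratedFDeriv_apply_smul (f : V → ℝ) (x e : V) (n : ℕ) (t : ℝ) :
    (iteratedFDeriv ℝ n f x fun _ => t • e) = t ^ n * iteratedFDeriv ℝ n f x fun _ => e := by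
  have := (iteratedFDeriv ℝ n f x).map_smul_univ (fun _ => t) (fun _ => e)
  simpa using this

lemma FormalMultilinearSeries.nnnorm_changeOrigin_mul_pow_le {p : FormalMultilinearSeries ℝ V ℝ}
    {r r' : ℝ≥0} (h : (r + r' : ℝ≥0∞) < p.radius) {y : V} (hy : ‖y‖₊ ≤ r) (n : ℕ) :
    ‖p.changeOrigin y n‖₊ * r' ^ n ≤
      ∑' s : Σ k l : ℕ, { s : Finset (Fin (k + l)) // s.card = l },
        ‖p (s.1 + s.2.1)‖₊ * r ^ s.2.1 * r' ^ s.1 := by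
  have hsum := p.changeOriginSeries_summable_aux₁ h
  have hyr : (‖y‖₊ : ℝ≥0∞) < p.radius :=
    lt_of_le_of_lt (by exact_mod_cast hy) (lt_of_le_of_lt le_self_add h)
  refine le_trans (mul_le_mul_left (p.nnnorm_changeOrigin_le n hyr) _) ?_
  rw [← NNReal.tsum_mul_right]
  have hsn := (NNReal.summable_sigma.1 hsum).1 n
  have hle : ∀ s : Σ l : ℕ, { s : Finset (Fin (n + l)) // s.card = l },
      ‖p (n + s.1)‖₊ * ‖y‖₊ ^ s.1 * r' ^ n ≤ ‖p (n + s.1)‖₊ * r ^ s.1 * r' ^ n := by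
    intro s; gcongr
  refine le_trans (Summable.tsum_le_tsum hle (NNReal.summable_of_le hle hsn) hsn) ?_
  rw [hsum.tsum_sigma' (NNReal.summable_sigma.1 hsum).1]
  exact (NNReal.summable_sigma.1 hsum).2.le_tsum n fun _ _ => zero_le

/-- Uniform Cauchy estimates near a point of analyticity. -/
lemma AnalyticAt.eventually_taylorCoeff {f : V → ℝ} {x₀ : V} (hf : AnalyticAt ℝ f x₀) :
    ∃ ρ > (0 : ℝ), ∃ C : ℝ, ∀ᶠ x in 𝓝 x₀, ∀ e : V, ‖e‖ ≤ 1 →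
      (∀ n, |taylorCoeff f x e n| * ρ ^ n ≤ C) ∧
      ∀ t : ℝ, |t| < ρ → HasSum (fun n => taylorCoeff f x e n * t ^ n) (f (x + t • e)) := by
  obtain ⟨p, r, h⟩ := hf
  obtain ⟨δ', hδ', hδr⟩ : ∃ δ' : ℝ≥0, 0 < δ' ∧ (δ' : ℝ≥0∞) < r := by
    obtain ⟨δ', h1, h2⟩ := ENNReal.lt_iff_exists_nnreal_btwn.1 h.r_pos
    exact ⟨δ', by exact_mod_cast h1, h2⟩
  set δ : ℝ≥0 := δ' / 2 with hδ
  have hδpos : 0 < δ := by positivity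
  have hδδ : (δ : ℝ≥0∞) + δ < r := by
    rw [← ENNReal.coe_add, hδ, add_halves]; exact hδr
  have hbound := fun {y : V} hy n => p.nnnorm_changeOrigin_mul_pow_le (y := y)
    (hδδ.trans_le h.r_le) hy n
  generalize (∑' s : Σ k l : ℕ, { s : Finset (Fin (k + l)) // s.card = l },
    ‖p (s.1 + s.2.1)‖₊ * δ ^ s.2.1 * δ ^ s.1) = S at hbound
  refine ⟨δ, hδpos, S, ?_⟩
  filter_upwards [Metric.ball_mem_nhds x₀ (show (0 : ℝ) < δ from hδpos)] with x hx e he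
  set y := x - x₀ with hy
  have hyδ : ‖y‖₊ ≤ δ := by
    rw [mem_ball_iff_norm] at hx
    exact_mod_cast hx.le
  have hyr : (‖y‖₊ : ℝ≥0∞) < r :=
    lt_of_le_of_lt (by exact_mod_cast hyδ) (lt_of_le_of_lt le_self_add hδδ)
  have hq : HasFPowerSeriesOnBall f (p.changeOrigin y) x (r - ‖y‖₊) := by
    simpa [hy] using h.changeOrigin hyr
  have hδle : (δ : ℝ≥0∞) ≤ r - ‖y‖₊ := by
    refine ENNReal.le_sub_of_add_le_right ENNReal.coe_ne_top (le_trans ?_ hδδ.le)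
    gcongr
  constructor
  · intro n
    have hfac : (n ! : ℝ) ≠ 0 := by positivity
    have hcoef : taylorCoeff f x e n = p.changeOrigin y n fun _ => e := by
      rw [taylorCoeff, ← hq.factorial_smul e n, nsmul_eq_mul, inv_mul_cancel_left₀ hfac]
    have h1 : |taylorCoeff f x e n| ≤ ‖p.changeOrigin y n‖ := by
      rw [hcoef, ← Real.norm_eq_abs]
      refine ((p.changeOrigin y n).le_opNorm _).trans ?_
      refine mul_le_of_le_one_right (norm_nonneg _) ?_
      simpa using pow_le_one₀ (norm_nonneg e) he
    calc |taylorCoeff f x e n| * (δ : ℝ) ^ n ≤ ‖p.changeOrigin y n‖ * (δ : ℝ) ^ n := by gcongr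
      _ ≤ S := by exact_mod_cast hbound hyδ n
  · intro t ht
    have hmem : t • e ∈ Metric.eball (0 : V) (r - ‖y‖₊) := by
      rw [mem_eball_zero_iff]
      refine lt_of_lt_of_le ?_ hδle
      rw [enorm_eq_nnnorm]
      have : ‖t • e‖ < δ := by
        rw [norm_smul]
        exact (mul_le_of_le_one_right (norm_nonneg _) he).trans_lt ht
      exact_mod_cast this
    refine (hq.hasSum_iteratedFDeriv hmem).congr_fun fun n => ?_
    rw [iteratedFDeriv_apply_smul, taylorCoeff, smul_eq_mul]
    ring

/-- A complex extension of a periodic real analytic function along segments of a fixed direction,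
with a uniform width and a uniform bound. -/
lemma exists_complex_extension {b : ℕ} {f : (Fin b → ℝ) → ℝ} (hf : ∀ x, AnalyticAt ℝ f x)
    (hper : LatticePeriodic f) :
    ∃ ρ > (0 : ℝ), ∃ C : ℝ, ∀ e : Fin b → ℝ, ‖e‖ ≤ 1 → ∃ F : (Fin b → ℝ) → ℂ → ℂ,
      (∀ x, DifferentiableOn ℂ (F x) (Metric.ball 0 ρ)) ∧
      (∀ x (t : ℝ), |t| < ρ → F x t = f (x + t • e)) ∧
      (∀ x, ∀ z ∈ Metric.ball (0 : ℂ) ρ, ‖F x z‖ ≤ C) ∧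
      ContinuousOn (fun q : (Fin b → ℝ) × ℂ => F q.1 q.2) (Set.univ ×ˢ Metric.ball 0 ρ) ∧
      LatticePeriodic F := by
  have hcd : ContDiff ℝ ⊤ f := contDiff_iff_contDiffAt.2 fun x => (hf x).contDiffAt
  have hcoef_per : ∀ (m : Fin b → ℤ) (x : Fin b → ℝ) e n,
      taylorCoeff f (x + intVec m) e n = taylorCoeff f x e n := by
    intro m x e n
    have h := iteratedFDeriv_comp_add_right (𝕜 := ℝ) (f := f) n (intVec m) x
    simp only [hper m] at h
    rw [taylorCoeff, taylorCoeff, ← h]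
  obtain ⟨ρ, hρ, C, hC⟩ : ∃ ρ > (0 : ℝ), ∃ C : ℝ, ∀ x ∈ Set.Icc (0 : Fin b → ℝ) 1,
      ∀ e : Fin b → ℝ, ‖e‖ ≤ 1 → (∀ n, |taylorCoeff f x e n| * ρ ^ n ≤ C) ∧
      ∀ t : ℝ, |t| < ρ → HasSum (fun n => taylorCoeff f x e n * t ^ n) (f (x + t • e)) := by
    refine (isCompact_Icc (a := (0 : Fin b → ℝ)) (b := 1)).induction_on
      (p := fun s => ∃ ρ > (0 : ℝ), ∃ C : ℝ, ∀ x ∈ s,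
      ∀ e : Fin b → ℝ, ‖e‖ ≤ 1 → (∀ n, |taylorCoeff f x e n| * ρ ^ n ≤ C) ∧
      ∀ t : ℝ, |t| < ρ → HasSum (fun n => taylorCoeff f x e n * t ^ n) (f (x + t • e)))
      ⟨1, one_pos, 0, by simp⟩ ?_ ?_ ?_
    · rintro s t hst ⟨ρ, hρ, C, h⟩
      exact ⟨ρ, hρ, C, fun x hx => h x (hst hx)⟩
    · rintro s t ⟨ρ, hρ, C, h⟩ ⟨ρ', hρ', C', h'⟩
      refine ⟨min ρ ρ', lt_min hρ hρ', max C C', ?_⟩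
      have hmin : 0 ≤ min ρ ρ' := (lt_min hρ hρ').le
      rintro x (hx | hx) e he
      · refine ⟨fun n => le_trans ?_ (((h x hx e he).1 n).trans (le_max_left _ _)),
          fun t ht => (h x hx e he).2 t (ht.trans_le (min_le_left _ _))⟩
        gcongr; exact min_le_left _ _
      · refine ⟨fun n => le_trans ?_ (((h' x hx e he).1 n).trans (le_max_right _ _)),
          fun t ht => (h' x hx e he).2 t (ht.trans_le (min_le_right _ _))⟩
        gcongr; exact min_le_right _ _
    · intro x _
      obtain ⟨ρ, hρ, C, h⟩ := (hf x).eventually_taylorCoeff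
      exact ⟨_, mem_nhdsWithin_of_mem_nhds h, ρ, hρ, C, fun y hy => hy⟩
  have hC' : ∀ x, ∀ e : Fin b → ℝ, ‖e‖ ≤ 1 → (∀ n, |taylorCoeff f x e n| * ρ ^ n ≤ C) ∧
      ∀ t : ℝ, |t| < ρ → HasSum (fun n => taylorCoeff f x e n * t ^ n) (f (x + t • e)) := by
    intro x e he
    obtain ⟨m, hm⟩ := exists_intVec_add_mem_Icc x
    have := hC _ hm e he
    simp only [hcoef_per, add_right_comm x (intVec m), hper m] at this
    exact this
  have hgeom : Summable fun n : ℕ => C * (1 / 2 : ℝ) ^ n :=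
    (summable_geometric_of_lt_one (by norm_num) (by norm_num)).mul_left C
  refine ⟨ρ / 2, by positivity, ∑' n : ℕ, C * (1 / 2 : ℝ) ^ n, fun e he => ?_⟩
  have hterm : ∀ x, ∀ z ∈ Metric.ball (0 : ℂ) (ρ / 2), ∀ n : ℕ,
      ‖(taylorCoeff f x e n : ℂ) * z ^ n‖ ≤ C * (1 / 2 : ℝ) ^ n := by
    intro x z hz n
    rw [mem_ball_zero_iff] at hz
    rw [norm_mul, norm_pow, Complex.norm_real, Real.norm_eq_abs]
    calc |taylorCoeff f x e n| * ‖z‖ ^ n ≤ |taylorCoeff f x e n| * (ρ * (1 / 2)) ^ n := by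
          gcongr; linarith
      _ = |taylorCoeff f x e n| * ρ ^ n * (1 / 2) ^ n := by rw [mul_pow]; ring
      _ ≤ _ := by gcongr; exact (hC' x e he).1 n
  refine ⟨fun x z => ∑' n : ℕ, (taylorCoeff f x e n : ℂ) * z ^ n, fun x => ?_, fun x t ht => ?_,
    fun x z hz => ?_, ?_, fun m x => ?_⟩
  · exact Complex.differentiableOn_tsum_of_summable_norm hgeom
      (fun n => (by fun_prop : Differentiable ℂ fun z : ℂ =>
        (taylorCoeff f x e n : ℂ) * z ^ n).differentiableOn) Metric.isOpen_ball
      (fun n z hz => hterm x z hz n)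
  · have h := (hC' x e he).2 t (by linarith)
    have h2 := (Complex.hasSum_ofReal.2 h).tsum_eq
    rw [← h2]
    push_cast
    rfl
  · exact tsum_of_norm_bounded hgeom.hasSum (hterm x z hz)
  · refine continuousOn_tsum (u := fun n => C * (1 / 2 : ℝ) ^ n) (fun n => ?_) hgeom
      (fun n q hq => hterm q.1 q.2 hq.2 n)
    have h1 : Continuous fun x => taylorCoeff f x e n :=
      continuous_const.mul ((continuous_eval_const _).comp (hcd.continuous_iteratedFDeriv le_top))
    exact (by fun_prop : Continuous fun q : (Fin b → ℝ) × ℂ =>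
      (taylorCoeff f q.1 e n : ℂ) * q.2 ^ n).continuousOn
  · funext z
    simp only [hcoef_per]

end ComplexExtension

section SubMeanValue

lemma continuousOn_cocycle {𝕜 Y : Type*} [RCLike 𝕜] [TopologicalSpace Y] {a : ℕ → Y → 𝕜}
    {s : Set Y} (ha : ∀ n, ContinuousOn (a n) s) (k : ℕ) (i j : Fin 2) :
    ContinuousOn (fun y => cocycle (fun n => a n y) k i j) s := by
  induction k generalizing i j with
  | zero => exact continuousOn_const
  | succ k ih =>
    have h0 := ih 0 j
    have h1 := ih 1 j
    have h2 := ha k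
    simp only [cocycle, Matrix.mul_apply, Fin.sum_univ_two]
    fin_cases i <;> simp [stepMat] <;> fun_prop

lemma continuousOn_logNorm {𝕜 Y : Type*} [RCLike 𝕜] [TopologicalSpace Y] {a : ℕ → Y → 𝕜}
    {s : Set Y} (ha : ∀ n, ContinuousOn (a n) s) (k : ℕ) :
    ContinuousOn (fun y => logNorm (fun n => a n y) k) s := by
  unfold logNorm
  refine ContinuousOn.div_const (ContinuousOn.log ?_ fun y _ => (sqNorm_cocycle_pos _ _).ne') _
  unfold sqNorm
  have := continuousOn_cocycle ha k
  fun_prop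

lemma continuous_logNorm {𝕜 Y : Type*} [RCLike 𝕜] [TopologicalSpace Y] {a : ℕ → Y → 𝕜}
    (ha : ∀ n, Continuous (a n)) (k : ℕ) : Continuous fun y => logNorm (fun n => a n y) k := by
  rw [← continuousOn_univ]
  exact continuousOn_logNorm (fun n => (ha n).continuousOn) k

lemma differentiableOn_cocycle {a : ℕ → ℂ → ℂ} {s : Set ℂ}
    (ha : ∀ n, DifferentiableOn ℂ (a n) s) (k : ℕ) (i j : Fin 2) :
    DifferentiableOn ℂ (fun z => cocycle (fun n => a n z) k i j) s := by
  induction k generalizing i j with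
  | zero => exact differentiableOn_const _
  | succ k ih =>
    have h0 := ih 0 j
    have h1 := ih 1 j
    have h2 := ha k
    simp only [cocycle, Matrix.mul_apply, Fin.sum_univ_two]
    fin_cases i <;> simp [stepMat] <;> fun_prop

lemma AnalyticOnNhd.log_norm_le_circleAverage {h : ℂ → ℂ} {c : ℂ} {R : ℝ} (hR : 0 < R)
    (hh : AnalyticOnNhd ℂ h (Metric.closedBall c R)) (hc : h c ≠ 0) :
    Real.log ‖h c‖ ≤ Real.circleAverage (fun z => Real.log ‖h z‖) c R := by
  have hh' : AnalyticOnNhd ℂ h (Metric.closedBall c |R|) := by rwa [abs_of_pos hR]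
  rw [hh'.circleAverage_log_norm hR.ne' hc]
  refine le_add_of_nonneg_left (finsum_nonneg fun u => ?_)
  by_cases hu : u ∈ Metric.closedBall c |R|
  · refine mul_nonneg (by exact_mod_cast MeromorphicOn.AnalyticOnNhd.divisor_nonneg hh' u) ?_
    rcases eq_or_ne (c - u) 0 with h0 | h0
    · simp [h0]
    · refine Real.log_nonneg ?_
      rw [Metric.mem_closedBall, abs_of_pos hR, dist_comm, dist_eq_norm] at hu
      rw [← div_eq_mul_inv, one_le_div (norm_pos_iff.2 h0)]
      exact hu
  · rw [Function.locallyFinsuppWithin.apply_eq_zero_of_notMem _ hu]; simp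

lemma logNorm_le_circleAverage {a : ℕ → ℂ → ℂ} {Ω : Set ℂ} (hΩ : IsOpen Ω)
    (ha : ∀ n, DifferentiableOn ℂ (a n) Ω) {c : ℂ} {R : ℝ} (hR : 0 < R)
    (hball : Metric.closedBall c R ⊆ Ω) (k : ℕ) :
    logNorm (fun n => a n c) k ≤
      Real.circleAverage (fun z => logNorm (fun n => a n z) k) c R := by
  set A := cocycle (fun n => a n c) k with hA
  set h : ℂ → ℂ := fun z =>
    ∑ i, ∑ j, (starRingEnd ℂ) (A i j) * cocycle (fun n => a n z) k i j with hh
  have hApos : 0 < sqNorm A := sqNorm_cocycle_pos _ _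
  have hhd : DifferentiableOn ℂ h Ω := by
    have := differentiableOn_cocycle ha k
    simp only [hh]
    fun_prop
  have hhan : AnalyticOnNhd ℂ h (Metric.closedBall c R) :=
    fun z hz => (hhd.analyticOnNhd hΩ) z (hball hz)
  have hhc : h c = (sqNorm A : ℂ) := by
    simp only [hh, sqNorm, ← hA, Complex.conj_mul']
    push_cast
    rfl
  have hhc' : ‖h c‖ = sqNorm A := by
    rw [hhc, Complex.norm_real, Real.norm_of_nonneg hApos.le]
  have hle : ∀ z, Real.log ‖h z‖ ≤
      Real.log (sqNorm A) / 2 + logNorm (fun n => a n z) k := by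
    intro z
    have hTpos := sqNorm_cocycle_pos (fun n => a n z) k
    have h1 : ‖h z‖ ^ 2 ≤ sqNorm A * sqNorm (cocycle (fun n => a n z) k) := by
      have e : h z = ∑ p : Fin 2 × Fin 2,
          (starRingEnd ℂ) (A p.1 p.2) * cocycle (fun n => a n z) k p.1 p.2 :=
        (Fintype.sum_prod_type' fun i j =>
          (starRingEnd ℂ) (A i j) * cocycle (fun n => a n z) k i j).symm
      have e2 : ‖h z‖ ≤ ∑ p : Fin 2 × Fin 2,
          ‖A p.1 p.2‖ * ‖cocycle (fun n => a n z) k p.1 p.2‖ := by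
        rw [e]
        refine (norm_sum_le _ _).trans_eq (Finset.sum_congr rfl fun p _ => ?_)
        rw [norm_mul, RCLike.norm_conj]
      refine (pow_le_pow_left₀ (norm_nonneg _) e2 2).trans
        ((Finset.sum_mul_sq_le_sq_mul_sq _ _ _).trans_eq ?_)
      simp only [sqNorm]
      rw [← Fintype.sum_prod_type' fun i j => ‖A i j‖ ^ 2,
        ← Fintype.sum_prod_type' fun i j => ‖cocycle (fun n => a n z) k i j‖ ^ 2]
    rcases (norm_nonneg (h z)).eq_or_lt with h0 | h0
    · rw [← h0, Real.log_zero]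
      have h3 : 0 ≤ Real.log (sqNorm A) / 2 := logNorm_nonneg (fun n => a n c) k
      have h4 := logNorm_nonneg (fun n => a n z) k
      linarith
    · have := Real.log_le_log (by positivity) h1
      rw [Real.log_mul hApos.ne' hTpos.ne', Real.log_pow] at this
      unfold logNorm
      push_cast at this
      linarith
  have hcont : ContinuousOn (fun z => logNorm (fun n => a n z) k) (Metric.sphere c |R|) := by
    refine continuousOn_logNorm (fun n => (ha n).continuousOn.mono ?_) k
    rw [abs_of_pos hR]
    exact Metric.sphere_subset_closedBall.trans hball
  have hci := hcont.circleIntegrable'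
  have hav := hhan.log_norm_le_circleAverage hR (by rw [hhc]; exact_mod_cast hApos.ne')
  have hmono := Real.circleAverage_mono (c := c) (R := R) (f₁ := fun z => Real.log ‖h z‖)
    (f₂ := fun z => Real.log (sqNorm A) / 2 + logNorm (fun n => a n z) k)
    (MeromorphicOn.circleIntegrable_log_norm (fun z hz => (hhan z (by
      rw [abs_of_pos hR] at hz; exact Metric.sphere_subset_closedBall hz)).meromorphicAt))
    ((continuousOn_const.add hcont).circleIntegrable') (fun z _ => hle z)
  rw [Real.circleAverage_fun_add (circleIntegrable_const _ _ _) hci,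
    Real.circleAverage_const] at hmono
  rw [hhc'] at hav
  have : logNorm (fun n => a n c) k = Real.log (sqNorm A) / 2 := rfl
  linarith

end SubMeanValue

section SineAverage

open Real in
/-- A continuous function which is dominated by its averages along `y + h sin` is dominated by
its chords. -/
lemma le_chord_of_le_sin_average {g : ℝ → ℝ} {p q : ℝ} (hpq : p < q)
    (hg : ContinuousOn g (Set.Icc p q))
    (hsub : ∀ y h, 0 < h → p ≤ y - h → y + h ≤ q →
      2 * π * g y ≤ ∫ φ in 0..2 * π, g (y + h * sin φ))
    {y : ℝ} (hy : y ∈ Set.Icc p q) :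
    g y ≤ ((q - y) * g p + (y - p) * g q) / (q - p) := by
  have hqp : 0 < q - p := sub_pos.2 hpq
  set α : ℝ := (g q - g p) / (q - p) with hα
  have hαq : α * (q - p) = g q - g p := div_mul_cancel₀ _ hqp.ne'
  have hchord : ((q - y) * g p + (y - p) * g q) / (q - p) = g p + α * (y - p) := by
    rw [div_eq_iff hqp.ne']; linear_combination (y - p) * hαq * (-1)
  rw [hchord]
  suffices H : ∀ ε > 0, g y - (g p + α * (y - p)) + ε * ((y - p) * (y - q)) ≤ 0 by
    by_contra! hlt
    have hN : 0 < (q - p) * (q - p) := mul_pos hqp hqp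
    have hb : -((q - p) * (q - p)) ≤ (y - p) * (y - q) := by
      nlinarith [hy.1, hy.2, mul_nonneg (sub_nonneg.2 hy.1) (sub_nonneg.2 hy.2),
        mul_le_mul (sub_le_sub_right hy.2 p) (sub_le_sub_left hy.1 q) (sub_nonneg.2 hy.2) hqp.le]
    set d := g y - (g p + α * (y - p)) with hd
    have hdpos : 0 < d := by rw [hd]; linarith
    have := H (d / (2 * ((q - p) * (q - p)))) (by positivity)
    have h2 : d / (2 * ((q - p) * (q - p))) * (-((q - p) * (q - p))) ≤
        d / (2 * ((q - p) * (q - p))) * ((y - p) * (y - q)) :=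
      mul_le_mul_of_nonneg_left hb (by positivity)
    have h3 : d / (2 * ((q - p) * (q - p))) * (-((q - p) * (q - p))) = -d / 2 := by
      field_simp
    linarith
  intro ε hε
  set k : ℝ → ℝ := fun y => g y - (g p + α * (y - p)) + ε * ((y - p) * (y - q)) with hk
  have hkc : ContinuousOn k (Set.Icc p q) := by simp only [hk]; fun_prop
  obtain ⟨z, hz, hmax⟩ := isCompact_Icc.exists_isMaxOn ⟨p, Set.left_mem_Icc.2 hpq.le⟩ hkc
  have hkp : k p = 0 := by simp [hk]
  have hkq : k q = 0 := by simp only [hk]; linear_combination (-1) * hαq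
  refine (hmax hy).trans ?_
  rcases hz.1.eq_or_lt with h1 | h1
  · rw [← h1]; exact hkp.le
  rcases hz.2.eq_or_lt with h2 | h2
  · rw [h2]; exact hkq.le
  exfalso
  set h := min (z - p) (q - z) with hh
  have hh0 : 0 < h := lt_min (sub_pos.2 h1) (sub_pos.2 h2)
  have hhp : p ≤ z - h := by linarith [min_le_left (z - p) (q - z)]
  have hhq : z + h ≤ q := by linarith [min_le_right (z - p) (q - z)]
  have hmem : ∀ φ, z + h * sin φ ∈ Set.Icc p q := fun φ =>
    ⟨by nlinarith [neg_one_le_sin φ], by nlinarith [sin_le_one φ]⟩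
  have hcont : Continuous fun φ => g (z + h * sin φ) :=
    hg.comp_continuous (by fun_prop) hmem
  have e1 : ∫ φ in 0..2 * π, k (z + h * sin φ) =
      (∫ φ in 0..2 * π, g (z + h * sin φ)) + (2 * π * (k z - g z) + ε * h ^ 2 * π) := by
    have : ∀ φ, k (z + h * sin φ) = g (z + h * sin φ) + ((k z - g z) +
        ((ε * (2 * z - p - q) * h - α * h) * sin φ + ε * h ^ 2 * sin φ ^ 2)) := by
      intro φ; simp only [hk]; ring
    simp_rw [this]
    rw [intervalIntegral.integral_add (hcont.intervalIntegrable _ _)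
        (Continuous.intervalIntegrable (by fun_prop) _ _),
      intervalIntegral.integral_add (Continuous.intervalIntegrable (by fun_prop) _ _)
        (Continuous.intervalIntegrable (by fun_prop) _ _),
      intervalIntegral.integral_add (Continuous.intervalIntegrable (by fun_prop) _ _)
        (Continuous.intervalIntegrable (by fun_prop) _ _),
      intervalIntegral.integral_const_mul, intervalIntegral.integral_const_mul, integral_sin,
      integral_sin_sq, intervalIntegral.integral_const]
    simp
  have e2 : ∫ φ in 0..2 * π, k (z + h * sin φ) ≤ ∫ φ in (0:ℝ)..2 * π, k z := by
    refine intervalIntegral.integral_mono_on (by positivity) ?_ (by simp) fun φ _ => hmax (hmem φ)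
    exact (hkc.comp_continuous (by fun_prop) hmem).intervalIntegrable _ _
  rw [e1, intervalIntegral.integral_const] at e2
  have e3 := hsub z h hh0 hhp hhq
  have : 0 < ε * h ^ 2 * π := by positivity
  simp only [smul_eq_mul, sub_zero] at e2
  linarith

end SineAverage

/-- A family of bounded nonnegative functions on a disc, indexed by the torus, which satisfy the
sub-mean value property and are translated into each other in the direction `e`. -/
structure IsSubmeanFamily {b : ℕ} (e : Fin b → ℝ) (ρ Λ : ℝ) (U : (Fin b → ℝ) → ℂ → ℝ) :
    Prop where
  pos : 0 < ρ
  nonneg : ∀ θ, ∀ z ∈ Metric.ball (0 : ℂ) ρ, 0 ≤ U θ z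
  le : ∀ θ, ∀ z ∈ Metric.ball (0 : ℂ) ρ, U θ z ≤ Λ
  cont : ContinuousOn (fun q : (Fin b → ℝ) × ℂ => U q.1 q.2) (Set.univ ×ˢ Metric.ball 0 ρ)
  per : LatticePeriodic U
  shift : ∀ θ, ∀ t : ℝ, ∀ z ∈ Metric.ball (0 : ℂ) ρ, (t : ℂ) + z ∈ Metric.ball (0 : ℂ) ρ →
    U (θ + t • e) z = U θ (t + z)
  submean : ∀ θ c R, 0 < R → Metric.closedBall c R ⊆ Metric.ball 0 ρ →
    U θ c ≤ Real.circleAverage (U θ) c R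

section L2Modulus

open Real

variable {b : ℕ} {e : Fin b → ℝ} {ρ Λ : ℝ} {U : (Fin b → ℝ) → ℂ → ℝ}

lemma continuous_integral_cube {Y : Type*} [TopologicalSpace Y] [FirstCountableTopology Y]
    [LocallyCompactSpace Y] {F : Y → (Fin b → ℝ) → ℝ} (hF : Continuous F.uncurry) :
    Continuous fun y => ∫ θ, F y θ ∂cubeMeasure b :=
  continuous_parametric_integral_of_continuous hF isCompact_Icc

lemma intervalIntegral_integral_cube_swap {F : ℝ → (Fin b → ℝ) → ℝ} (hF : Continuous F.uncurry)
    (s t : ℝ) : ∫ φ in s..t, ∫ θ, F φ θ ∂cubeMeasure b = ∫ θ, (∫ φ in s..t, F φ θ) ∂cubeMeasure b := by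
  refine intervalIntegral_integral_swap ?_
  have : IntegrableOn F.uncurry (Set.uIcc s t ×ˢ Set.Icc 0 1) (volume.prod volume) :=
    hF.continuousOn.integrableOn_compact (isCompact_uIcc.prod isCompact_Icc)
  rw [cubeMeasure, Measure.prod_restrict]
  exact this.mono_set (Set.prod_mono_left Set.uIoc_subset_uIcc)

namespace IsSubmeanFamily

lemma continuous_comp (hU : IsSubmeanFamily e ρ Λ U) {Y : Type*} [TopologicalSpace Y]
    {g : Y → Fin b → ℝ} {z : Y → ℂ} (hg : Continuous g) (hz : Continuous z)
    (hm : ∀ y, z y ∈ Metric.ball (0 : ℂ) ρ) : Continuous fun y => U (g y) (z y) :=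
  hU.cont.comp_continuous (f := fun y => (g y, z y)) (by fun_prop) fun y => ⟨trivial, hm y⟩

lemma integral_comp_shift (hU : IsSubmeanFamily e ρ Λ U) {G : ℝ → ℝ} {t : ℝ} {z : ℂ}
    (hz : z ∈ Metric.ball (0 : ℂ) ρ) (htz : (t : ℂ) + z ∈ Metric.ball (0 : ℂ) ρ) :
    ∫ θ, G (U θ (t + z)) ∂cubeMeasure b = ∫ θ, G (U θ z) ∂cubeMeasure b := by
  simp_rw [← hU.shift _ t z hz htz]
  exact (hU.per.comp fun w => G (w z)).integral_add (t • e)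

lemma circleMap_mem (y : ℝ) {h : ℝ} (hh : 0 ≤ h) (hy : |y| + h < ρ) (φ : ℝ) :
    circleMap (y * Complex.I) h φ ∈ Metric.ball (0 : ℂ) ρ := by
  rw [mem_ball_zero_iff]
  refine lt_of_le_of_lt ?_ hy
  rw [circleMap]
  refine (norm_add_le _ _).trans (le_of_eq ?_)
  rw [norm_mul, norm_mul, Complex.norm_I, Complex.norm_exp_ofReal_mul_I, Complex.norm_real,
    Complex.norm_real, Real.norm_eq_abs, Real.norm_eq_abs, abs_of_nonneg hh, mul_one, mul_one]

lemma circleMap_mul_I (y h φ : ℝ) : circleMap (y * Complex.I) h φ =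
    ((h * cos φ : ℝ) : ℂ) + ((y + h * sin φ : ℝ) : ℂ) * Complex.I := by
  rw [circleMap, Complex.exp_mul_I]
  push_cast
  ring

lemma mul_I_mem {y : ℝ} (hy : |y| < ρ) : (y : ℂ) * Complex.I ∈ Metric.ball (0 : ℂ) ρ := by
  simpa using hy

lemma abs_add_mul_sin_lt {y h φ : ℝ} (hh : 0 ≤ h) (hy : |y| + h < ρ) : |y + h * sin φ| < ρ := by
  refine lt_of_le_of_lt (abs_add_le _ _) (lt_of_le_of_lt ?_ hy)
  rw [abs_mul, abs_of_nonneg hh]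
  nlinarith [abs_sin_le_one φ]

lemma integral_circle_sub_sq_le (hU : IsSubmeanFamily e ρ Λ U) {y h : ℝ} (hh : 0 < h)
    (hy : |y| + h < ρ) :
    ∫ φ in 0..2 * π, ∫ θ, (U θ (circleMap (y * Complex.I) h φ) - U θ (y * Complex.I)) ^ 2
        ∂cubeMeasure b ≤
      (∫ φ in 0..2 * π, ∫ θ, U θ ((y + h * sin φ : ℝ) * Complex.I) ^ 2 ∂cubeMeasure b) -
        2 * π * ∫ θ, U θ (y * Complex.I) ^ 2 ∂cubeMeasure b := by
  set c : ℂ := y * Complex.I with hc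
  have hcm : c ∈ Metric.ball (0 : ℂ) ρ := mul_I_mem (by linarith)
  have hzm := circleMap_mem y hh.le hy
  have hW : Continuous fun q : ℝ × (Fin b → ℝ) => U q.2 (circleMap c h q.1) :=
    hU.continuous_comp (by fun_prop) (by fun_prop) fun q => hzm q.1
  have hw : Continuous fun q : ℝ × (Fin b → ℝ) => U q.2 c :=
    hU.continuous_comp (by fun_prop) (by fun_prop) fun q => hcm
  have hW1 : ∀ φ, Continuous fun θ => U θ (circleMap c h φ) := fun φ =>
    hU.continuous_comp (by fun_prop) (by fun_prop) fun q => hzm φ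
  have hW2 : ∀ θ, Continuous fun φ => U θ (circleMap c h φ) := fun θ =>
    hU.continuous_comp (by fun_prop) (by fun_prop) fun φ => hzm φ
  have hw1 : Continuous fun θ => U θ c :=
    hU.continuous_comp (by fun_prop) (by fun_prop) fun q => hcm
  have e1 : ∀ φ, ∫ θ, (U θ (circleMap c h φ) - U θ c) ^ 2 ∂cubeMeasure b =
      (∫ θ, U θ ((y + h * sin φ : ℝ) * Complex.I) ^ 2 ∂cubeMeasure b) -
        2 * (∫ θ, U θ (circleMap c h φ) * U θ c ∂cubeMeasure b) +
        ∫ θ, U θ c ^ 2 ∂cubeMeasure b := by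
    intro φ
    have hs : ∫ θ, U θ (circleMap c h φ) ^ 2 ∂cubeMeasure b =
        ∫ θ, U θ ((y + h * sin φ : ℝ) * Complex.I) ^ 2 ∂cubeMeasure b := by
      have h1 := hzm φ
      rw [circleMap_mul_I] at h1 ⊢
      exact hU.integral_comp_shift (G := fun x => x ^ 2) (mul_I_mem (abs_add_mul_sin_lt hh.le hy)) h1
    have i1 := (hW1 φ).fun_pow 2
    have i2 := ((hW1 φ).fun_mul hw1).const_mul 2
    rw [← hs, ← integral_const_mul, ← integral_sub i1.integrable_cube i2.integrable_cube,
      ← integral_add (i1.fun_sub i2).integrable_cube (hw1.fun_pow 2).integrable_cube]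
    refine integral_congr_ae (.of_forall fun θ => ?_)
    ring
  have hcE : Continuous fun φ => ∫ θ, U θ ((y + h * sin φ : ℝ) * Complex.I) ^ 2 ∂cubeMeasure b :=
    continuous_integral_cube (F := fun φ θ => U θ ((y + h * sin φ : ℝ) * Complex.I) ^ 2)
      ((hU.continuous_comp (Y := ℝ × (Fin b → ℝ)) (by fun_prop)
        (z := fun q => ((y + h * sin q.1 : ℝ) : ℂ) * Complex.I) (by fun_prop)
        fun q => mul_I_mem (abs_add_mul_sin_lt hh.le hy)).pow 2)
  have hcM : Continuous fun φ => ∫ θ, U θ (circleMap c h φ) * U θ c ∂cubeMeasure b :=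
    continuous_integral_cube (F := fun φ θ => U θ (circleMap c h φ) * U θ c) (hW.mul hw)
  simp_rw [e1]
  rw [intervalIntegral.integral_add ((hcE.fun_sub (hcM.const_mul 2)).intervalIntegrable _ _) (by simp),
    intervalIntegral.integral_sub (hcE.intervalIntegrable _ _)
      ((hcM.const_mul 2).intervalIntegrable _ _), intervalIntegral.integral_const_mul,
    intervalIntegral.integral_const,
    intervalIntegral_integral_cube_swap (F := fun φ θ => U θ (circleMap c h φ) * U θ c) (hW.mul hw)]
  have key : 2 * π * ∫ θ, U θ c ^ 2 ∂cubeMeasure b ≤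
      ∫ θ, (∫ φ in 0..2 * π, U θ (circleMap c h φ) * U θ c) ∂cubeMeasure b := by
    rw [← integral_const_mul]
    refine integral_mono ((hw1.fun_pow 2).const_mul _).integrable_cube ?_ fun θ => ?_
    · refine Continuous.integrable_cube ?_
      refine intervalIntegral.continuous_parametric_intervalIntegral_of_continuous'
        (f := fun θ φ => U θ (circleMap c h φ) * U θ c) ?_ _ _
      exact (hW.mul hw).comp continuous_swap
    · simp only [intervalIntegral.integral_mul_const]
      have h1 := hU.submean θ c h hh (fun z hz => by
        rw [Metric.mem_closedBall, dist_eq_norm] at hz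
        rw [mem_ball_zero_iff]
        have h2 : ‖c‖ = |y| := by simp [hc]
        have := norm_sub_norm_le z c
        linarith)
      rw [Real.circleAverage_def, smul_eq_mul, inv_mul_eq_div, le_div_iff₀ (by positivity)] at h1
      have h2 := mul_le_mul_of_nonneg_right h1 (hU.nonneg θ c hcm)
      linarith
  simp only [smul_eq_mul, sub_zero]
  linarith

end IsSubmeanFamily
end L2Modulus

section L2Modulus

open Real

variable {b : ℕ} {e : Fin b → ℝ} {ρ Λ : ℝ} {U : (Fin b → ℝ) → ℂ → ℝ}

lemma add_sq_le_two_mul (x y z : ℝ) : (x - z) ^ 2 ≤ 2 * (x - y) ^ 2 + 2 * (y - z) ^ 2 := by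
  nlinarith [sq_nonneg (x - y - (y - z))]

/-- The mean square increment of a periodic function. -/
def sqIncrement {b : ℕ} (u : (Fin b → ℝ) → ℝ) (v : Fin b → ℝ) : ℝ :=
  ∫ θ, (u (θ + v) - u θ) ^ 2 ∂cubeMeasure b

lemma sqIncrement_nonneg (u : (Fin b → ℝ) → ℝ) (v : Fin b → ℝ) : 0 ≤ sqIncrement u v :=
  integral_nonneg fun _ => sq_nonneg _

lemma sqIncrement_add_le {u : (Fin b → ℝ) → ℝ} (hc : Continuous u) (hp : LatticePeriodic u)
    (v w : Fin b → ℝ) : sqIncrement u (v + w) ≤ 2 * sqIncrement u v + 2 * sqIncrement u w := by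
  have hw : sqIncrement u w = ∫ θ, (u (θ + v + w) - u (θ + v)) ^ 2 ∂cubeMeasure b := by
    have : LatticePeriodic fun θ => (u (θ + w) - u θ) ^ 2 := fun m x => by
      simp only [hp m x, hp.comp_add w m x]
    exact (this.integral_add v).symm
  rw [hw, sqIncrement, sqIncrement, ← integral_const_mul, ← integral_const_mul, ← integral_add
    (Continuous.integrable_cube (by fun_prop)) (Continuous.integrable_cube (by fun_prop))]
  refine integral_mono (Continuous.integrable_cube (by fun_prop))
    (Continuous.integrable_cube (by fun_prop)) fun θ => ?_
  have := add_sq_le_two_mul (u (θ + v + w)) (u (θ + v)) (u θ)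
  simp only [← add_assoc]
  linarith

lemma continuous_sqIncrement_smul {u : (Fin b → ℝ) → ℝ} (hc : Continuous u) (e : Fin b → ℝ) :
    Continuous fun t : ℝ => sqIncrement u (t • e) :=
  continuous_integral_cube (F := fun t θ => (u (θ + t • e) - u θ) ^ 2) (by
    unfold Function.uncurry; fun_prop)

namespace IsSubmeanFamily

lemma zero_mem (hU : IsSubmeanFamily e ρ Λ U) : (0 : ℂ) ∈ Metric.ball (0 : ℂ) ρ :=
  Metric.mem_ball_self hU.pos

lemma continuous_zero (hU : IsSubmeanFamily e ρ Λ U) : Continuous fun θ => U θ 0 :=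
  hU.continuous_comp continuous_id continuous_const fun _ => hU.zero_mem

lemma energy_nonneg (y : ℝ) : 0 ≤ ∫ θ, U θ (y * Complex.I) ^ 2 ∂cubeMeasure b :=
  integral_nonneg fun _ => sq_nonneg _

lemma energy_le (hU : IsSubmeanFamily e ρ Λ U) {y : ℝ} (hy : |y| < ρ) :
    ∫ θ, U θ (y * Complex.I) ^ 2 ∂cubeMeasure b ≤ Λ ^ 2 := by
  have hm := mul_I_mem hy
  have : ∫ θ, U θ (y * Complex.I) ^ 2 ∂cubeMeasure b ≤ ∫ θ, Λ ^ 2 ∂cubeMeasure b := by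
    refine integral_mono (Continuous.integrable_cube ?_) (integrable_const _) fun θ =>
      pow_le_pow_left₀ (hU.nonneg _ _ hm) (hU.le _ _ hm) 2
    exact (hU.continuous_comp continuous_id continuous_const fun _ => hm).pow 2
  simpa using this

lemma energy_le_add (hU : IsSubmeanFamily e ρ Λ U) {y : ℝ} (hy : |y| ≤ ρ / 2) :
    ∫ θ, U θ (y * Complex.I) ^ 2 ∂cubeMeasure b ≤
      (∫ θ, U θ 0 ^ 2 ∂cubeMeasure b) + |y| * Λ ^ 2 / (ρ / 2) := by
  set En : ℝ → ℝ := fun y => ∫ θ, U θ (y * Complex.I) ^ 2 ∂cubeMeasure b with hEn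
  have hρ := hU.pos
  have hlt : ∀ y : ℝ, |y| ≤ ρ / 2 → |y| < ρ := fun y h => by linarith
  have hcont : ContinuousOn En (Set.Icc (-(ρ / 2)) (ρ / 2)) := by
    rw [continuousOn_iff_continuous_domRestrict]
    exact continuous_integral_cube
      (F := fun (y : Set.Icc (-(ρ / 2)) (ρ / 2)) θ => U θ ((y : ℝ) * Complex.I) ^ 2)
      ((hU.continuous_comp (Y := Set.Icc (-(ρ / 2)) (ρ / 2) × (Fin b → ℝ)) (by fun_prop)
        (z := fun q => ((q.1 : ℝ) : ℂ) * Complex.I) (by fun_prop)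
        fun q => mul_I_mem (hlt _ (abs_le.2 q.1.2))).pow 2)
  have hsub : ∀ y h, 0 < h → -(ρ / 2) ≤ y - h → y + h ≤ ρ / 2 →
      2 * π * En y ≤ ∫ φ in 0..2 * π, En (y + h * sin φ) := by
    intro y h hh h1 h2
    have h3 : |y| + h < ρ := by
      have : |y| ≤ ρ / 2 - h := abs_le.2 ⟨by linarith, by linarith⟩
      linarith
    have h4 := hU.integral_circle_sub_sq_le hh h3
    have h5 : 0 ≤ ∫ φ in 0..2 * π, ∫ θ,
        (U θ (circleMap (y * Complex.I) h φ) - U θ (y * Complex.I)) ^ 2 ∂cubeMeasure b :=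
      intervalIntegral.integral_nonneg (by positivity) fun φ _ =>
        integral_nonneg fun θ => sq_nonneg _
    simp only [hEn]
    linarith
  have hEn0 : En 0 = ∫ θ, U θ 0 ^ 2 ∂cubeMeasure b := by simp [hEn]
  have hE0 : 0 ≤ En 0 := energy_nonneg 0
  rw [← hEn0]
  change En y ≤ _
  rcases le_total 0 y with h0 | h0
  · rw [abs_of_nonneg h0] at hy ⊢
    have h1 := le_chord_of_le_sin_average (p := 0) (q := ρ / 2) (g := En) (by linarith)
      (hcont.mono (Set.Icc_subset_Icc_left (by linarith)))
      (fun y h hh h1 h2 => hsub y h hh (by linarith) h2) (y := y) ⟨h0, hy⟩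
    refine h1.trans ?_
    have h2 : En (ρ / 2) ≤ Λ ^ 2 := hU.energy_le (hlt _ (by rw [abs_of_pos (by linarith)]))
    rw [sub_zero, sub_zero, div_le_iff₀ (by linarith), add_mul,
      div_mul_cancel₀ _ (by linarith : ρ / 2 ≠ 0)]
    nlinarith
  · rw [abs_of_nonpos h0] at hy ⊢
    have h1 := le_chord_of_le_sin_average (p := -(ρ / 2)) (q := 0) (g := En) (by linarith)
      (hcont.mono (Set.Icc_subset_Icc_right (by linarith)))
      (fun y h hh h1 h2 => hsub y h hh h1 (by linarith)) (y := y) ⟨by linarith, h0⟩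
    refine h1.trans ?_
    have h2 : En (-(ρ / 2)) ≤ Λ ^ 2 :=
      hU.energy_le (hlt _ (by rw [abs_neg, abs_of_pos (by linarith)]))
    rw [zero_sub, zero_sub, neg_neg, div_le_iff₀ (by linarith), add_mul,
      div_mul_cancel₀ _ (by linarith : ρ / 2 ≠ 0)]
    nlinarith

lemma integral_sqIncrement_cos_le (hU : IsSubmeanFamily e ρ Λ U) {h : ℝ} (hh : 0 < h)
    (hhρ : h ≤ ρ / 2) :
    ∫ φ in 0..π, sqIncrement (fun θ => U θ 0) ((2 * h * cos φ) • e) ≤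
      8 * π * (h * Λ ^ 2 / (ρ / 2)) := by
  have hρ := hU.pos
  have hh1 : |(0 : ℝ)| + h < ρ := by simp; linarith
  set u : (Fin b → ℝ) → ℝ := fun θ => U θ 0 with hu
  have huc : Continuous u := hU.continuous_zero
  have hup : LatticePeriodic u := hU.per.comp fun w => w 0
  set a : ℝ → ℝ := fun φ => ∫ θ, (U θ (circleMap 0 h φ) - U θ 0) ^ 2 ∂cubeMeasure b with ha
  have hzm : ∀ φ, circleMap 0 h φ ∈ Metric.ball (0 : ℂ) ρ := fun φ => by
    simpa using circleMap_mem 0 hh.le hh1 φ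
  have hac : Continuous a := by
    refine continuous_integral_cube (F := fun φ θ => (U θ (circleMap 0 h φ) - U θ 0) ^ 2) ?_
    have h1 : Continuous fun q : ℝ × (Fin b → ℝ) => U q.2 (circleMap 0 h q.1) :=
      hU.continuous_comp (by fun_prop) (by fun_prop) fun q => hzm q.1
    exact (h1.sub (huc.comp continuous_snd)).pow 2
  have ha0 : ∀ φ, 0 ≤ a φ := fun φ => integral_nonneg fun _ => sq_nonneg _
  have hcircle : ∫ φ in 0..2 * π, a φ ≤ 2 * π * (h * Λ ^ 2 / (ρ / 2)) := by
    have h1 := hU.integral_circle_sub_sq_le (y := 0) hh hh1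
    simp only [Complex.ofReal_zero, zero_mul, zero_add] at h1
    refine h1.trans ?_
    have h2 : ∫ φ in 0..2 * π, ∫ θ, U θ ((h * sin φ : ℝ) * Complex.I) ^ 2 ∂cubeMeasure b ≤
        ∫ φ in 0..2 * π, ((∫ θ, U θ 0 ^ 2 ∂cubeMeasure b) + h * Λ ^ 2 / (ρ / 2)) := by
      refine intervalIntegral.integral_mono_on (by positivity) ?_ (by simp) fun φ _ => ?_
      · have hm : ∀ φ, ((h * sin φ : ℝ) : ℂ) * Complex.I ∈ Metric.ball (0 : ℂ) ρ := fun φ =>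
          mul_I_mem (by simpa using abs_add_mul_sin_lt (φ := φ) hh.le hh1)
        have hc : Continuous fun q : ℝ × (Fin b → ℝ) =>
            U q.2 (((h * sin q.1 : ℝ) : ℂ) * Complex.I) :=
          hU.continuous_comp (by fun_prop) (by fun_prop) fun q => hm q.1
        exact (continuous_integral_cube
          (F := fun (φ : ℝ) (θ : Fin b → ℝ) => U θ (((h * sin φ : ℝ) : ℂ) * Complex.I) ^ 2)
          (hc.fun_pow 2)).intervalIntegrable _ _
      · have h3 : |h * sin φ| ≤ h := by
          rw [abs_mul, abs_of_pos hh]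
          nlinarith [abs_sin_le_one φ]
        refine (hU.energy_le_add (h3.trans hhρ)).trans ?_
        gcongr
    rw [intervalIntegral.integral_const, smul_eq_mul, sub_zero] at h2
    linarith
  have hhalf : ∫ φ in 0..π, a φ ≤ 2 * π * (h * Λ ^ 2 / (ρ / 2)) :=
    (intervalIntegral.integral_mono_interval le_rfl pi_pos.le (by linarith [pi_pos])
      (.of_forall ha0) (hac.intervalIntegrable _ _)).trans hcircle
  have hpt : ∀ φ, sqIncrement u ((2 * h * cos φ) • e) ≤ 2 * a φ + 2 * a (π - φ) := by
    intro φ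
    set y : ℂ := ((h * sin φ : ℝ) : ℂ) * Complex.I with hy
    set t : ℝ := h * cos φ with ht
    have hym : y ∈ Metric.ball (0 : ℂ) ρ :=
      mul_I_mem (by simpa using abs_add_mul_sin_lt (φ := φ) hh.le hh1)
    have e1 : circleMap 0 h φ = (t : ℂ) + y := by
      have h3 := circleMap_mul_I 0 h φ
      simpa only [Complex.ofReal_zero, zero_mul, zero_add] using h3
    have e2 : circleMap 0 h (π - φ) = ((-t : ℝ) : ℂ) + y := by
      have h3 := circleMap_mul_I 0 h (π - φ)
      simpa only [Complex.ofReal_zero, zero_mul, zero_add, cos_pi_sub, sin_pi_sub, mul_neg] using h3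
    have hXc : Continuous fun θ => U θ y :=
      hU.continuous_comp continuous_id continuous_const fun _ => hym
    have hXp : LatticePeriodic fun θ => U θ y := hU.per.comp fun w => w y
    have key : ∀ s : ℝ, (s : ℂ) + y ∈ Metric.ball (0 : ℂ) ρ →
        ∫ θ, (U θ (s + y) - U θ 0) ^ 2 ∂cubeMeasure b =
          ∫ θ, (U θ y - u (θ - s • e)) ^ 2 ∂cubeMeasure b := by
      intro s hs
      have hp : LatticePeriodic fun θ => (U θ y - u (θ - s • e)) ^ 2 := fun m x => by
        have h1 := hup.comp_add (-(s • e)) m x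
        simp only [← sub_eq_add_neg] at h1
        simp only [hXp m x, h1]
      rw [← hp.integral_add (s • e)]
      refine integral_congr_ae (.of_forall fun θ => ?_)
      simp only [add_sub_cancel_right, hU.shift θ s y hym hs, hu]
    have k1 : a φ = ∫ θ, (U θ y - u (θ - t • e)) ^ 2 ∂cubeMeasure b := by
      have := hzm φ
      rw [e1] at this
      rw [← key t this, ← e1]
    have k2 : a (π - φ) = ∫ θ, (U θ y - u (θ + t • e)) ^ 2 ∂cubeMeasure b := by
      have := hzm (π - φ)
      rw [e2] at this
      have h3 := key (-t) this
      rw [← e2] at h3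
      simpa only [neg_smul, sub_neg_eq_add] using h3
    have hp : LatticePeriodic fun θ => (u (θ + (2 * h * cos φ) • e) - u θ) ^ 2 := fun m x => by
      simp only [hup m x, hup.comp_add _ m x]
    rw [k1, k2, sqIncrement, ← hp.integral_add (-(t • e)), ← integral_const_mul,
      ← integral_const_mul, ← integral_add
      (Continuous.integrable_cube (by fun_prop)) (Continuous.integrable_cube (by fun_prop))]
    refine integral_mono (Continuous.integrable_cube (by fun_prop))
      (Continuous.integrable_cube (by fun_prop)) fun θ => ?_
    have e3 : θ + -(t • e) + (2 * h * cos φ) • e = θ + t • e := by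
      rw [show 2 * h * cos φ = t + t by rw [ht]; ring, add_smul]; abel
    simp only [e3]
    simp only [← sub_eq_add_neg]
    have := add_sq_le_two_mul (u (θ + t • e)) (U θ y) (u (θ - t • e))
    nlinarith [sq_nonneg (U θ y - u (θ + t • e))]
  have hac' : Continuous fun φ => a (π - φ) := by fun_prop
  have hsc := continuous_sqIncrement_smul huc e
  calc ∫ φ in 0..π, sqIncrement u ((2 * h * cos φ) • e)
      ≤ ∫ φ in 0..π, (2 * a φ + 2 * a (π - φ)) :=
        intervalIntegral.integral_mono_on pi_pos.le
          ((hsc.comp (by fun_prop : Continuous fun φ => 2 * h * cos φ)).intervalIntegrable _ _)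
          (Continuous.intervalIntegrable (by fun_prop) _ _) fun φ _ => hpt φ
    _ = 4 * ∫ φ in 0..π, a φ := by
        rw [intervalIntegral.integral_add (Continuous.intervalIntegrable (by fun_prop) _ _)
          (Continuous.intervalIntegrable (by fun_prop) _ _), intervalIntegral.integral_const_mul,
          intervalIntegral.integral_const_mul, intervalIntegral.integral_comp_sub_left]
        simp only [sub_self, sub_zero]
        ring
    _ ≤ _ := by linarith

lemma sqIncrement_le (hU : IsSubmeanFamily e ρ Λ U) {h : ℝ} (hh : 0 < h) (hhρ : h ≤ ρ / 2) :
    sqIncrement (fun θ => U θ 0) (h • e) ≤ 64 * π * (h * Λ ^ 2 / (ρ / 2)) := by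
  set u : (Fin b → ℝ) → ℝ := fun θ => U θ 0 with hu
  have huc : Continuous u := hU.continuous_zero
  have hup : LatticePeriodic u := hU.per.comp fun w => w 0
  set w : ℝ → ℝ := fun t => sqIncrement u (t • e) with hw
  have hwc : Continuous w := continuous_sqIncrement_smul huc e
  have hw0 : ∀ t, 0 ≤ w t := fun t => sqIncrement_nonneg _ _
  have h1 := hU.integral_sqIncrement_cos_le hh hhρ
  change ∫ φ in 0..π, w (2 * h * cos φ) ≤ _ at h1
  have h2 : ∫ φ in 0..π, w (2 * h * cos φ) * sin φ ≤ ∫ φ in 0..π, w (2 * h * cos φ) := by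
    refine intervalIntegral.integral_mono_on pi_pos.le
      (Continuous.intervalIntegrable (by fun_prop) _ _)
      (Continuous.intervalIntegrable (by fun_prop) _ _) fun φ _ => ?_
    nlinarith [hw0 (2 * h * cos φ), sin_le_one φ]
  have h3 := intervalIntegral.integral_comp_mul_deriv (a := 0) (b := π)
    (f := fun φ => 2 * h * cos φ) (f' := fun φ => -(2 * h) * sin φ) (g := w)
    (fun φ _ => ((hasDerivAt_cos φ).const_mul (2 * h)).congr_deriv (by ring))
    (by fun_prop) hwc
  simp only [Function.comp_apply, cos_zero, cos_pi, mul_one, mul_neg] at h3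
  rw [intervalIntegral.integral_symm (-(2 * h)) (2 * h)] at h3
  have h4 : ∫ φ in 0..π, w (2 * h * cos φ) * (-(2 * h) * sin φ) =
      -(2 * h) * ∫ φ in 0..π, w (2 * h * cos φ) * sin φ := by
    rw [← intervalIntegral.integral_const_mul]
    exact intervalIntegral.integral_congr fun φ _ => by ring
  rw [h4] at h3
  have h5 : ∫ t in 0..h, w t ≤ ∫ t in -(2 * h)..2 * h, w t :=
    intervalIntegral.integral_mono_interval (by linarith) hh.le (by linarith) (.of_forall hw0)
      (hwc.intervalIntegrable _ _)
  have h6 : ∫ t in (0:ℝ)..h, w h ≤ ∫ t in (0:ℝ)..h, (2 * w t + 2 * w (h - t)) := by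
    refine intervalIntegral.integral_mono_on hh.le (by simp)
      (Continuous.intervalIntegrable (by fun_prop) _ _) fun t _ => ?_
    have := sqIncrement_add_le huc hup (t • e) ((h - t) • e)
    rwa [← add_smul, add_sub_cancel] at this
  have h7 : ∫ t in (0:ℝ)..h, (2 * w t + 2 * w (h - t)) = 4 * ∫ t in (0:ℝ)..h, w t := by
    rw [intervalIntegral.integral_add (Continuous.intervalIntegrable (by fun_prop) _ _)
      (Continuous.intervalIntegrable (by fun_prop) _ _), intervalIntegral.integral_const_mul,
      intervalIntegral.integral_const_mul, intervalIntegral.integral_comp_sub_left]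
    simp only [sub_self, sub_zero]
    ring
  rw [h7, intervalIntegral.integral_const, smul_eq_mul, sub_zero] at h6
  have h8 : h * w h ≤ h * (64 * π * (h * Λ ^ 2 / (ρ / 2))) := by nlinarith
  exact le_of_mul_le_mul_left h8 hh

lemma integral_abs_sub_le (hU : IsSubmeanFamily e ρ Λ U) {h : ℝ} (hh : 0 < h) (hhρ : h ≤ ρ / 2) :
    ∫ θ, |U (θ + h • e) 0 - U θ 0| ∂cubeMeasure b ≤
      (1 + 64 * π * (Λ ^ 2 / (ρ / 2))) / 2 * √h := by
  have hs : 0 < √h := sqrt_pos.2 hh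
  have huc : Continuous fun θ => U θ 0 := hU.continuous_zero
  have hd : Continuous fun θ => U (θ + h • e) 0 - U θ 0 :=
    (huc.comp (continuous_add_const (h • e))).sub huc
  have h1 := hU.sqIncrement_le hh hhρ
  have h2 : ∫ θ, |U (θ + h • e) 0 - U θ 0| ∂cubeMeasure b ≤
      ∫ θ, (√h / 2 + (1 / (2 * √h)) * (U (θ + h • e) 0 - U θ 0) ^ 2) ∂cubeMeasure b := by
    refine integral_mono hd.abs.integrable_cube (Continuous.integrable_cube (by fun_prop))
      fun θ => ?_
    simp only
    rw [← sq_abs (U (θ + h • e) 0 - U θ 0)]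
    set x := |U (θ + h • e) 0 - U θ 0|
    have : √h / 2 + 1 / (2 * √h) * x ^ 2 - x = (√h - x) ^ 2 / (2 * √h) := by
      field_simp; ring
    have h3 : 0 ≤ (√h - x) ^ 2 / (2 * √h) := by positivity
    linarith
  rw [integral_add (integrable_const _) (Continuous.integrable_cube (by fun_prop)),
    integral_const_mul] at h2
  simp only [integral_const, probReal_univ, one_smul] at h2
  refine h2.trans ?_
  have h4 : 1 / (2 * √h) * ∫ θ, (U (θ + h • e) 0 - U θ 0) ^ 2 ∂cubeMeasure b ≤
      1 / (2 * √h) * (64 * π * (h * Λ ^ 2 / (ρ / 2))) :=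
    mul_le_mul_of_nonneg_left h1 (by positivity)
  have h5 : 1 / (2 * √h) * (64 * π * (h * Λ ^ 2 / (ρ / 2))) =
      64 * π * (Λ ^ 2 / (ρ / 2)) / 2 * √h := by
    have : h = √h * √h := (mul_self_sqrt hh.le).symm
    have hρ := hU.pos
    field_simp
    rw [sq_sqrt hh.le]
  linarith

end IsSubmeanFamily
end L2Modulus

section ComplexExtension

lemma logNorm_ofReal (a : ℕ → ℝ) (k : ℕ) : logNorm (fun n => (a n : ℂ)) k = logNorm a k := by
  have h : ∀ i j, cocycle (fun n => (a n : ℂ)) k i j = ((cocycle a k i j : ℝ) : ℂ) := by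
    induction k with
    | zero => intro i j; fin_cases i <;> fin_cases j <;> simp [cocycle]
    | succ k ih =>
      intro i j
      simp only [cocycle, Matrix.mul_apply, Fin.sum_univ_two, ih]
      fin_cases i <;> simp [stepMat]
  simp only [logNorm, sqNorm, h, Complex.norm_real]

/-- Complexified translates agree wherever both are defined. -/
lemma complex_extension_shift {b : ℕ} {f : (Fin b → ℝ) → ℝ} {e : Fin b → ℝ} {ρ : ℝ}
    {F : (Fin b → ℝ) → ℂ → ℂ} (hd : ∀ x, DifferentiableOn ℂ (F x) (Metric.ball 0 ρ))
    (hF : ∀ x (t : ℝ), |t| < ρ → F x t = f (x + t • e)) (x : Fin b → ℝ) (t : ℝ) {z : ℂ}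
    (hz : z ∈ Metric.ball (0 : ℂ) ρ) (htz : (t : ℂ) + z ∈ Metric.ball (0 : ℂ) ρ) :
    F (x + t • e) z = F x (t + z) := by
  set D : Set ℂ := Metric.ball 0 ρ ∩ Metric.ball (-(t : ℂ)) ρ with hD
  have hDo : IsOpen D := Metric.isOpen_ball.inter Metric.isOpen_ball
  have hDc : IsPreconnected D :=
    ((convex_ball _ _).inter (convex_ball _ _)).isPreconnected
  have hmaps : ∀ w ∈ D, (t : ℂ) + w ∈ Metric.ball (0 : ℂ) ρ := fun w hw => by
    have := hw.2
    rw [Metric.mem_ball, dist_eq_norm] at this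
    rw [mem_ball_zero_iff]
    rwa [sub_neg_eq_add, add_comm] at this
  have hzD : z ∈ D := by
    refine ⟨hz, ?_⟩
    rw [Metric.mem_ball, dist_eq_norm, sub_neg_eq_add, add_comm]
    exact mem_ball_zero_iff.1 htz
  have hg1 : AnalyticOnNhd ℂ (F (x + t • e)) D :=
    ((hd _).mono Set.inter_subset_left).analyticOnNhd hDo
  have hg2 : AnalyticOnNhd ℂ (fun w => F x (t + w)) D :=
    ((hd x).comp (by fun_prop) hmaps).analyticOnNhd hDo
  have ht : |t| < 2 * ρ := by
    have h1 := mem_ball_zero_iff.1 hz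
    have h2 := mem_ball_zero_iff.1 htz
    have h3 := norm_sub_le ((t : ℂ) + z) z
    rw [add_sub_cancel_right, Complex.norm_real, Real.norm_eq_abs] at h3
    linarith
  have ht2 : |-(t / 2)| < ρ := by rw [abs_neg, abs_div, abs_two]; linarith
  have ht3 : |t + -(t / 2)| < ρ := by
    rw [show t + -(t / 2) = t / 2 by ring, abs_div, abs_two]; linarith
  have hmid : ((-(t / 2) : ℝ) : ℂ) ∈ D := by
    refine ⟨by rwa [mem_ball_zero_iff, Complex.norm_real], ?_⟩
    rw [Metric.mem_ball, dist_eq_norm, sub_neg_eq_add, add_comm, ← Complex.ofReal_add,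
      Complex.norm_real]
    exact ht3
  refine hg1.eqOn_of_preconnected_of_frequently_eq hg2 hDc hmid ?_ hzD
  have htend : Tendsto (fun s : ℝ => (s : ℂ)) (nhdsWithin (-(t / 2)) {-(t / 2)}ᶜ)
      (nhdsWithin ((-(t / 2) : ℝ) : ℂ) {((-(t / 2) : ℝ) : ℂ)}ᶜ) :=
    tendsto_nhdsWithin_of_tendsto_nhds_of_eventually_within _
      ((Complex.continuous_ofReal.tendsto _).mono_left nhdsWithin_le_nhds)
      (eventually_nhdsWithin_of_forall fun s hs h => hs (Complex.ofReal_injective h))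
  refine htend.frequently (Eventually.frequently ?_)
  refine nhdsWithin_le_nhds ?_
  have c1 : ∀ᶠ s : ℝ in nhds (-(t / 2)), |s| < ρ :=
    continuous_abs.continuousAt.eventually_lt continuousAt_const ht2
  have c2 : ∀ᶠ s : ℝ in nhds (-(t / 2)), |t + s| < ρ :=
    ContinuousAt.eventually_lt (by fun_prop) continuousAt_const ht3
  filter_upwards [c1, c2] with s h1 h2
  rw [hF _ s h1, ← Complex.ofReal_add, hF _ _ h2, add_smul, add_assoc]

end ComplexExtension

/-- The normalised logarithm of the norm of the transfer matrix. -/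
def meanLog {b : ℕ} (f : (Fin b → ℝ) → ℝ) (lam E : ℝ) (ω : Fin b → ℝ) (k : ℕ)
    (θ : Fin b → ℝ) : ℝ :=
  logNorm (fun n => E - lam * f (θ + (n : ℝ) • ω)) k / k

section Modulus

variable {b : ℕ} {f : (Fin b → ℝ) → ℝ}

lemma isSubmeanFamily_logNorm {e : Fin b → ℝ} {ρ C : ℝ} (hρ : 0 < ρ) {F : (Fin b → ℝ) → ℂ → ℂ}
    (hd : ∀ x, DifferentiableOn ℂ (F x) (Metric.ball 0 ρ))
    (hF : ∀ x (t : ℝ), |t| < ρ → F x t = f (x + t • e))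
    (hC : ∀ x, ∀ z ∈ Metric.ball 0 ρ, ‖F x z‖ ≤ C)
    (hc : ContinuousOn (fun q : (Fin b → ℝ) × ℂ => F q.1 q.2) (Set.univ ×ˢ Metric.ball 0 ρ))
    (hp : LatticePeriodic F) (lam E : ℝ) (ω : Fin b → ℝ) {k : ℕ} (hk : 1 ≤ k) :
    IsSubmeanFamily e ρ (Real.log ((|E| + |lam| * C) ^ 2 + 2) / 2)
      (fun θ z => logNorm (fun n => (E : ℂ) - lam * F (θ + (n : ℝ) • ω) z) k / k) where
  pos := hρ
  nonneg θ z _ := div_nonneg (logNorm_nonneg _ _) (Nat.cast_nonneg _)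
  le θ z hz := by
    have hk' : (0 : ℝ) < k := by exact_mod_cast hk
    rw [div_le_iff₀ hk', mul_comm]
    refine logNorm_le (fun n => ?_) hk
    refine (norm_sub_le _ _).trans ?_
    rw [norm_mul, Complex.norm_real, Complex.norm_real, Real.norm_eq_abs, Real.norm_eq_abs]
    gcongr
    exact hC _ _ hz
  cont := by
    refine (continuousOn_logNorm
      (a := fun n (q : (Fin b → ℝ) × ℂ) => (E : ℂ) - lam * F (q.1 + (n : ℝ) • ω) q.2)
      (fun n => ?_) k).div_const _
    refine continuousOn_const.sub (continuousOn_const.mul ?_)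
    exact hc.comp (f := fun q : (Fin b → ℝ) × ℂ => (q.1 + (n : ℝ) • ω, q.2)) (by fun_prop)
      fun q hq => ⟨trivial, hq.2⟩
  per m x := by
    funext z
    have : ∀ n : ℕ, F (x + intVec m + (n : ℝ) • ω) z = F (x + (n : ℝ) • ω) z := fun n =>
      congrFun (hp.comp_add ((n : ℝ) • ω) m x) z
    simp only [this]
  shift θ t z hz htz := by
    have : ∀ n : ℕ, F (θ + t • e + (n : ℝ) • ω) z = F (θ + (n : ℝ) • ω) (t + z) := fun n => by
      rw [add_right_comm]
      exact complex_extension_shift hd hF _ t hz htz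
    simp only [this]
  submean θ c R hR hb := by
    have h1 := logNorm_le_circleAverage (a := fun n z => (E : ℂ) - lam * F (θ + (n : ℝ) • ω) z)
      Metric.isOpen_ball (fun n => (differentiableOn_const _).sub ((hd _).const_mul _)) hR hb k
    have h2 : Real.circleAverage
        (fun z => logNorm (fun n => (E : ℂ) - lam * F (θ + (n : ℝ) • ω) z) k / k) c R =
        Real.circleAverage
          (fun z => logNorm (fun n => (E : ℂ) - lam * F (θ + (n : ℝ) • ω) z) k) c R / k := by
      simp only [Real.circleAverage_def, smul_eq_mul, intervalIntegral.integral_div, mul_div_assoc]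
    rw [h2]
    gcongr

lemma continuous_of_analyticAt (hf : ∀ x, AnalyticAt ℝ f x) : Continuous f :=
  continuous_iff_continuousAt.2 fun x => (hf x).continuousAt

/-- The normalised log-norms of the transfer matrices are equicontinuous in mean. -/
lemma exists_integral_abs_meanLog_sub_le (hf : ∀ x, AnalyticAt ℝ f x) (hper : LatticePeriodic f)
    (lam E : ℝ) : ∃ C, 0 ≤ C ∧ ∀ ω k, 1 ≤ k → ∀ v,
      ∫ θ, |meanLog f lam E ω k (θ + v) - meanLog f lam E ω k θ| ∂cubeMeasure b ≤ C * √‖v‖ := by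
  obtain ⟨ρ, hρ, C, h⟩ := exists_complex_extension hf hper
  set Λ := Real.log ((|E| + |lam| * C) ^ 2 + 2) / 2 with hΛ
  have hΛ0 : 0 ≤ Λ := div_nonneg (Real.log_nonneg (by nlinarith [sq_nonneg (|E| + |lam| * C)]))
    zero_le_two
  have hs : 0 < √(ρ / 2) := Real.sqrt_pos.2 (by linarith)
  set C₁ := (1 + 64 * Real.pi * (Λ ^ 2 / (ρ / 2))) / 2 with hC₁
  have hC₁0 : 0 ≤ C₁ := by have := Real.pi_pos; positivity
  refine ⟨C₁ + Λ / √(ρ / 2), by positivity, fun ω k hk v => ?_⟩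
  rcases eq_or_ne v 0 with rfl | hv
  · simp
  have hv0 : 0 < ‖v‖ := norm_pos_iff.2 hv
  obtain ⟨F, hd, hF, hC, hc, hp⟩ := h (‖v‖⁻¹ • v) (by
    rw [norm_smul, norm_inv, norm_norm, inv_mul_cancel₀ hv0.ne'])
  have hU := isSubmeanFamily_logNorm hρ hd hF hC hc hp lam E ω hk
  have hU0 : ∀ θ, meanLog f lam E ω k θ =
      logNorm (fun n => (E : ℂ) - lam * F (θ + (n : ℝ) • ω) 0) k / k := by
    intro θ
    rw [meanLog, ← logNorm_ofReal]
    have : ∀ n : ℕ, F (θ + (n : ℝ) • ω) 0 = f (θ + (n : ℝ) • ω) := fun n => by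
      have := hF (θ + (n : ℝ) • ω) 0 (by simpa using hρ)
      simpa using this
    simp only [this]
    push_cast
    rfl
  rcases le_or_gt ‖v‖ (ρ / 2) with hle | hlt
  · have h1 := hU.integral_abs_sub_le hv0 hle
    rw [smul_smul, mul_inv_cancel₀ hv0.ne', one_smul] at h1
    simp only [hU0]
    refine h1.trans ?_
    gcongr
    exact le_add_of_nonneg_right (by positivity)
  · have h1 : ∫ θ, |meanLog f lam E ω k (θ + v) - meanLog f lam E ω k θ| ∂cubeMeasure b ≤
        ∫ θ, Λ ∂cubeMeasure b := by
      refine integral_mono_of_nonneg (.of_forall fun _ => abs_nonneg _) (integrable_const _)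
        (.of_forall fun θ => ?_)
      have a1 := hU.nonneg θ 0 hU.zero_mem
      have a2 := hU.le θ 0 hU.zero_mem
      have a3 := hU.nonneg (θ + v) 0 hU.zero_mem
      have a4 := hU.le (θ + v) 0 hU.zero_mem
      rw [← hU0] at a1 a2 a3 a4
      exact abs_le.2 ⟨by linarith, by linarith⟩
    rw [integral_const, probReal_univ, one_smul] at h1
    refine h1.trans ?_
    rw [add_mul]
    have h2 : √(ρ / 2) ≤ √‖v‖ := Real.sqrt_le_sqrt hlt.le
    have h3 : Λ ≤ Λ / √(ρ / 2) * √‖v‖ := by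
      rw [div_mul_eq_mul_div, le_div_iff₀ hs]
      gcongr
    have h4 : 0 ≤ C₁ * √‖v‖ := by positivity
    linarith

end Modulus

section Recurrence

variable {b : ℕ}

/-- At scale `2 ^ (-s)`, the time `K` is, up to a small shift `l`, a return time of the rotation
by `ω`. -/
def IsAlmostReturn (ω : Fin b → ℝ) (K s : ℕ) : Prop :=
  ∃ l : ℤ, |l| * 2 ^ s ≤ K ∧ ∃ m : Fin b → ℤ,
    ‖((K : ℝ) - l) • ω - intVec m‖ ≤ (1 / 4) ^ s

/-- The points of the orbit with times in `A` are pairwise more than `r` apart on the torus. -/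
def IsOrbitSeparated (ω : Fin b → ℝ) (r : ℝ) (A : Finset ℕ) : Prop :=
  ∀ x ∈ A, ∀ y ∈ A, x ≠ y → ∀ m : Fin b → ℤ, r < ‖((x : ℝ) - y) • ω - intVec m‖

open Classical in
/-- The maximal number of pairwise `r`-separated orbit points with times at most `T`. -/
def orbitPacking (ω : Fin b → ℝ) (r : ℝ) (T : ℕ) : ℕ :=
  ((Finset.range (T + 1)).powerset.filter (IsOrbitSeparated ω r)).sup Finset.card

lemma card_le_orbitPacking {ω : Fin b → ℝ} {r : ℝ} {T : ℕ} {A : Finset ℕ}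
    (hA : A ⊆ Finset.range (T + 1)) (hs : IsOrbitSeparated ω r A) :
    A.card ≤ orbitPacking ω r T := by
  classical
  exact Finset.le_sup (f := Finset.card)
    (Finset.mem_filter.2 ⟨Finset.mem_powerset.2 hA, hs⟩)

lemma exists_card_eq_orbitPacking (ω : Fin b → ℝ) (r : ℝ) (T : ℕ) :
    ∃ A ⊆ Finset.range (T + 1), IsOrbitSeparated ω r A ∧ A.card = orbitPacking ω r T := by
  classical
  obtain ⟨A, hA, h⟩ := Finset.exists_mem_eq_sup
    ((Finset.range (T + 1)).powerset.filter (IsOrbitSeparated ω r))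
    ⟨∅, by simp [IsOrbitSeparated]⟩ Finset.card
  rw [Finset.mem_filter, Finset.mem_powerset] at hA
  exact ⟨A, hA.1, hA.2, h.symm⟩

lemma orbitPacking_pos (ω : Fin b → ℝ) (r : ℝ) (T : ℕ) : 1 ≤ orbitPacking ω r T := by
  have : IsOrbitSeparated ω r {0} := by
    intro x hx y hy hxy
    simp_all
  simpa using card_le_orbitPacking (T := T) (A := {0}) (by simp) this

lemma orbitPacking_le (ω : Fin b → ℝ) (s T : ℕ) :
    orbitPacking ω ((1 / 4) ^ s) T ≤ 2 ^ (2 * s * b) := by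
  obtain ⟨A, -, hs, hc⟩ := exists_card_eq_orbitPacking ω ((1 / 4) ^ s) T
  rw [← hc]
  have h4 : (0 : ℝ) < 4 ^ s := by positivity
  have hlt : ∀ (x : ℕ) (i : Fin b), ⌊Int.fract ((x : ℝ) * ω i) * 4 ^ s⌋₊ < 4 ^ s := by
    intro x i
    rw [Nat.floor_lt (by have := Int.fract_nonneg ((x : ℝ) * ω i); positivity)]
    push_cast
    have := Int.fract_lt_one ((x : ℝ) * ω i)
    nlinarith
  let box : ℕ → Fin b → Fin (4 ^ s) := fun x i => ⟨_, hlt x i⟩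
  have hinj : Set.InjOn box A := by
    intro x hx y hy hxy
    by_contra hne
    have := hs x hx y hy hne fun i => ⌊(x : ℝ) * ω i⌋ - ⌊(y : ℝ) * ω i⌋
    refine absurd this (not_lt.2 ((pi_norm_le_iff_of_nonneg (by positivity)).2 fun i => ?_))
    have hi : ⌊Int.fract ((x : ℝ) * ω i) * 4 ^ s⌋₊ = ⌊Int.fract ((y : ℝ) * ω i) * 4 ^ s⌋₊ :=
      congrArg Fin.val (congrFun hxy i)
    have hx0 := Int.fract_nonneg ((x : ℝ) * ω i)
    have hy0 := Int.fract_nonneg ((y : ℝ) * ω i)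
    have b1 := Nat.floor_le (a := Int.fract ((x : ℝ) * ω i) * 4 ^ s) (by positivity)
    have b2 := Nat.lt_floor_add_one (Int.fract ((x : ℝ) * ω i) * 4 ^ s)
    have b3 := Nat.floor_le (a := Int.fract ((y : ℝ) * ω i) * 4 ^ s) (by positivity)
    have b4 := Nat.lt_floor_add_one (Int.fract ((y : ℝ) * ω i) * 4 ^ s)
    rw [hi] at b1 b2
    have e : (((x : ℝ) - y) • ω - intVec fun i => ⌊(x : ℝ) * ω i⌋ - ⌊(y : ℝ) * ω i⌋) i =
        Int.fract ((x : ℝ) * ω i) - Int.fract ((y : ℝ) * ω i) := by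
      simp only [Pi.sub_apply, Pi.smul_apply, smul_eq_mul, intVec, Int.fract]
      push_cast
      ring
    rw [e, Real.norm_eq_abs, one_div, inv_pow, ← one_div, le_div_iff₀ h4, ← abs_of_pos h4, ← abs_mul,
      sub_mul]
    exact abs_le.2 ⟨by linarith, by linarith⟩
  calc A.card = (A.image box).card := (Finset.card_image_of_injOn hinj).symm
    _ ≤ Fintype.card (Fin b → Fin (4 ^ s)) := Finset.card_le_univ _
    _ = 2 ^ (2 * s * b) := by
      simp [pow_mul]

lemma two_mul_orbitPacking_le {ω : Fin b → ℝ} {K s T : ℕ} (hT : T * 2 ^ s ≤ K)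
    (h : ¬ IsAlmostReturn ω K s) :
    2 * orbitPacking ω ((1 / 4) ^ s) T ≤ orbitPacking ω ((1 / 4) ^ s) (2 * K) := by
  obtain ⟨A, hA, hs, hc⟩ := exists_card_eq_orbitPacking ω ((1 / 4) ^ s) T
  have hTK : T ≤ K := (Nat.le_mul_of_pos_right T (by positivity)).trans hT
  have hAT : ∀ x ∈ A, x ≤ T := fun x hx => Nat.lt_succ_iff.1 (Finset.mem_range.1 (hA hx))
  have far : ∀ x ∈ A, ∀ y ∈ A, ∀ m : Fin b → ℤ,
      (1 / 4) ^ s < ‖(((K + x : ℕ) : ℝ) - y) • ω - intVec m‖ := by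
    intro x hx y hy m
    by_contra! hle
    refine h ⟨(y : ℤ) - x, ?_, m, ?_⟩
    · have h1 : |(y : ℤ) - x| ≤ T := by
        have := hAT x hx
        have := hAT y hy
        rw [abs_le]; constructor <;> omega
      have h2 : |(y : ℤ) - x| * 2 ^ s ≤ (T : ℤ) * 2 ^ s := by gcongr
      exact h2.trans (by exact_mod_cast hT)
    · have e : (K : ℝ) - (((y : ℤ) - x : ℤ) : ℝ) = ((K + x : ℕ) : ℝ) - y := by push_cast; ring
      rwa [e]
  have hdisj : Disjoint A (A.map (addLeftEmbedding K)) := by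
    rw [Finset.disjoint_left]
    intro y hy hy'
    obtain ⟨x, hx, rfl⟩ := Finset.mem_map.1 hy'
    have := far x hx _ hy 0
    simp only [addLeftEmbedding_apply, sub_self, zero_smul, zero_sub, norm_neg] at this
    have h0 : intVec (0 : Fin b → ℤ) = 0 := by funext i; simp [intVec]
    rw [h0, norm_zero] at this
    exact absurd this (not_lt.2 (by positivity))
  have hsep : IsOrbitSeparated ω ((1 / 4) ^ s) (A ∪ A.map (addLeftEmbedding K)) := by
    intro x hx y hy hxy m
    rw [Finset.mem_union, Finset.mem_map] at hx hy
    rcases hx with hx | ⟨x, hx, rfl⟩ <;> rcases hy with hy | ⟨y, hy, rfl⟩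
    · exact hs x hx y hy hxy m
    · have := far y hy x hx (-m)
      rw [intVec_neg] at this
      have e : ((x : ℝ) - (addLeftEmbedding K y : ℕ)) • ω - intVec m =
          -((((K + y : ℕ) : ℝ) - x) • ω - -intVec m) := by
        simp only [addLeftEmbedding_apply, sub_smul]
        abel
      rwa [e, norm_neg]
    · exact far x hx y hy m
    · have hne : x ≠ y := fun h => hxy (by rw [h])
      have := hs x hx y hy hne m
      have e : ((addLeftEmbedding K x : ℕ) : ℝ) - (addLeftEmbedding K y : ℕ) = x - y := by
        simp
      rwa [e]
  have := card_le_orbitPacking (T := 2 * K) ?_ hsep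
  · rwa [Finset.card_union_of_disjoint hdisj, Finset.card_map, hc, ← two_mul] at this
  · refine Finset.union_subset (fun x hx => ?_) fun x hx => ?_
    · have := hAT x hx
      exact Finset.mem_range.2 (by omega)
    · obtain ⟨y, hy, rfl⟩ := Finset.mem_map.1 hx
      have := hAT y hy
      simp only [addLeftEmbedding_apply, Finset.mem_range]
      omega

lemma sum_le_of_window_jump {q : ℕ → ℕ} {N s : ℕ} (hN : ∀ n, q n ≤ N) (hq : ∀ n, q n ≤ q (n + (s + 1)))
    (P : ℕ → Prop) [DecidablePred P] (hP : ∀ n, P n → q n + 1 ≤ q (n + (s + 1))) (n : ℕ) :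
    ∑ i ∈ Finset.range n, (if P i then 1 else 0) ≤ (s + 1) * N := by
  have key : ∑ i ∈ Finset.range n, (if P i then 1 else 0) + ∑ j ∈ Finset.range (s + 1), q j ≤
      ∑ j ∈ Finset.range (s + 1), q (n + j) := by
    induction n with
    | zero => simp
    | succ n ih =>
      have h1 : ∑ j ∈ Finset.range (s + 1), q (n + 1 + j) + q n =
          ∑ j ∈ Finset.range (s + 1), q (n + j) + q (n + (s + 1)) := by
        rw [← Finset.sum_range_succ (fun j => q (n + j)), Finset.sum_range_succ' (fun j => q (n + j))]
        simp [add_comm, add_left_comm]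
      rw [Finset.sum_range_succ]
      have h2 := hP n
      have h3 := hq n
      split_ifs with h
      · have := h2 h; omega
      · omega
  refine (Nat.le_add_right _ _).trans (key.trans ?_)
  refine (Finset.sum_le_card_nsmul _ _ N fun j _ => hN _).trans ?_
  simp

lemma orbitPacking_mono (ω : Fin b → ℝ) (r : ℝ) : Monotone (orbitPacking ω r) := by
  intro S T hST
  obtain ⟨A, hA, hs, hc⟩ := exists_card_eq_orbitPacking ω r S
  rw [← hc]
  exact card_le_orbitPacking (hA.trans (Finset.range_mono (by omega))) hs

open Classical in
/-- Along a dyadic sequence of times, almost-returns at a given scale fail only boundedly often,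
uniformly in the rotation vector. -/
lemma sum_not_isAlmostReturn_le (ω : Fin b → ℝ) (k s n : ℕ) :
    ∑ i ∈ Finset.range n, (if IsAlmostReturn ω (2 ^ i * k) s then 0 else 1) ≤
      (2 * b + 1) * (s + 1) ^ 2 := by
  set q : ℕ → ℕ := fun i => Nat.log 2 (orbitPacking ω ((1 / 4) ^ s) (2 ^ i * k)) with hq
  have hN : ∀ i, q i ≤ 2 * s * b := fun i =>
    (Nat.log_mono_right (orbitPacking_le ω s _)).trans (Nat.log_pow (by norm_num) _).le
  have hmono : ∀ i, q i ≤ q (i + (s + 1)) := fun i => Nat.log_mono_right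
    (orbitPacking_mono ω _ (Nat.mul_le_mul_right _ (Nat.pow_le_pow_right (by norm_num) (by omega))))
  have hjump : ∀ i, ¬ IsAlmostReturn ω (2 ^ (s + i) * k) s → q i + 1 ≤ q (i + (s + 1)) := by
    intro i hi
    have h1 := two_mul_orbitPacking_le (T := 2 ^ i * k) (by rw [pow_add]; ring_nf; rfl) hi
    have h2 := Nat.log_mul_base (b := 2) one_lt_two
      (Nat.one_le_iff_ne_zero.1 (orbitPacking_pos ω ((1 / 4) ^ s) (2 ^ i * k)))
    simp only [hq]
    rw [← h2, mul_comm _ 2, show 2 ^ (i + (s + 1)) * k = 2 * (2 ^ (s + i) * k) by ring]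
    exact Nat.log_mono_right h1
  have h1 := sum_le_of_window_jump hN hmono
    (fun i => ¬ IsAlmostReturn ω (2 ^ (s + i) * k) s) hjump n
  have h2 : ∑ i ∈ Finset.range n, (if IsAlmostReturn ω (2 ^ i * k) s then 0 else 1) ≤
      ∑ i ∈ Finset.range (s + n), (if IsAlmostReturn ω (2 ^ i * k) s then 0 else 1) :=
    Finset.sum_le_sum_of_subset (Finset.range_mono (by omega))
  rw [Finset.sum_range_add] at h2
  have h3 : ∑ i ∈ Finset.range s, (if IsAlmostReturn ω (2 ^ i * k) s then 0 else 1) ≤ s := by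
    refine (Finset.sum_le_card_nsmul _ _ 1 fun j _ => ?_).trans (by simp)
    split_ifs <;> simp
  simp only [ite_not] at h1
  nlinarith

open Classical in
lemma exists_scale_le {R : ℕ → Prop} {s₀ : ℕ} (h₀ : R s₀) {S : ℕ} (hS : s₀ ≤ S) :
    ∃ s, R s ∧ (1 / 2 : ℝ) ^ s ≤ (1 / 2) ^ S +
      ∑ t ∈ Finset.Ico s₀ S, (1 / 2) ^ t * (if R (t + 1) then 0 else 1) := by
  induction S, hS using Nat.le_induction with
  | base => exact ⟨s₀, h₀, by simp⟩
  | succ S hS ih =>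
    rw [Finset.sum_Ico_succ_top hS]
    by_cases h : R (S + 1)
    · refine ⟨S + 1, h, ?_⟩
      simp only [h, if_true, mul_zero, add_zero]
      refine le_add_of_nonneg_right (Finset.sum_nonneg fun t _ => ?_)
      split_ifs <;> positivity
    · obtain ⟨s, hs, hle⟩ := ih
      refine ⟨s, hs, hle.trans ?_⟩
      simp only [h, if_false, mul_one]
      have : (0 : ℝ) ≤ (1 / 2) ^ (S + 1) := by positivity
      linarith

/-- Along a dyadic sequence of times, the best scales of almost-return have small total sum. -/
lemma exists_scales_sum_le (b : ℕ) {ε : ℝ} (hε : 0 < ε) :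
    ∃ s₀ : ℕ, ∀ (ω : Fin b → ℝ) (k : ℕ), (∀ i, IsAlmostReturn ω (2 ^ i * k) s₀) → ∀ n : ℕ,
      ∃ σ : ℕ → ℕ, (∀ i, IsAlmostReturn ω (2 ^ i * k) (σ i)) ∧
        ∑ i ∈ Finset.range n, (1 / 2 : ℝ) ^ σ i ≤ ε := by
  classical
  set a : ℕ → ℝ := fun t => (1 / 2 : ℝ) ^ t * ((2 * b + 1) * (t + 2) ^ 2) with ha
  have ha0 : ∀ t, 0 ≤ a t := fun t => by positivity
  have hsum : Summable a := by
    have h0 := summable_pow_mul_geometric_of_norm_lt_one 0 (r := (1 / 2 : ℝ)) (by norm_num)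
    have h1 := summable_pow_mul_geometric_of_norm_lt_one 1 (r := (1 / 2 : ℝ)) (by norm_num)
    have h2 := summable_pow_mul_geometric_of_norm_lt_one 2 (r := (1 / 2 : ℝ)) (by norm_num)
    refine ((h2.add ((h1.mul_left 4).add (h0.mul_left 4))).mul_left (2 * b + 1 : ℝ)).congr fun t => ?_
    simp only [ha]
    ring
  have htail : Tendsto (fun s => (1 / 2 : ℝ) ^ s + ((∑' t, a t) - ∑ t ∈ Finset.range s, a t)) atTop
      (nhds (0 + ((∑' t, a t) - ∑' t, a t))) :=
    (tendsto_pow_atTop_nhds_zero_of_lt_one (by norm_num) (by norm_num)).add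
      (tendsto_const_nhds.sub hsum.hasSum.tendsto_sum_nat)
  rw [sub_self, add_zero] at htail
  obtain ⟨s₀, hs₀⟩ := (htail.eventually (gt_mem_nhds hε)).exists
  refine ⟨s₀, fun ω k h₀ n => ?_⟩
  choose σ hσ hle using fun i =>
    exists_scale_le (R := IsAlmostReturn ω (2 ^ i * k)) (h₀ i) (Nat.le_add_right s₀ n)
  refine ⟨σ, hσ, (Finset.sum_le_sum fun i _ => hle i).trans (le_trans ?_ hs₀.le)⟩
  rw [Finset.sum_add_distrib, Finset.sum_comm]
  refine add_le_add ?_ ?_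
  · rw [Finset.sum_const, Finset.card_range, nsmul_eq_mul, pow_add]
    have h1 : (n : ℝ) * (1 / 2) ^ n ≤ 1 := by
      rw [one_div, inv_pow, ← div_eq_mul_inv, div_le_one (by positivity)]
      exact_mod_cast Nat.lt_two_pow_self.le
    have h2 : (0 : ℝ) ≤ (1 / 2) ^ s₀ := by positivity
    nlinarith
  · have h1 : ∀ t ∈ Finset.Ico s₀ (s₀ + n), ∑ i ∈ Finset.range n,
        (1 / 2 : ℝ) ^ t * (if IsAlmostReturn ω (2 ^ i * k) (t + 1) then 0 else 1) ≤ a t := by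
      intro t _
      rw [← Finset.mul_sum]
      refine mul_le_mul_of_nonneg_left ?_ (by positivity)
      have := sum_not_isAlmostReturn_le ω k (t + 1) n
      have h2 : ((∑ i ∈ Finset.range n,
          (if IsAlmostReturn ω (2 ^ i * k) (t + 1) then 0 else 1) : ℕ) : ℝ) ≤
          (((2 * b + 1) * (t + 1 + 1) ^ 2 : ℕ) : ℝ) := by exact_mod_cast this
      push_cast at h2
      refine h2.trans (le_of_eq ?_)
      ring
    refine (Finset.sum_le_sum h1).trans ?_
    have h3 := Finset.sum_range_add_sum_Ico a (Nat.le_add_right s₀ n)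
    have h4 := hsum.sum_le_tsum (Finset.range (s₀ + n)) fun t _ => ha0 t
    linarith

end Recurrence

section AbsIncrement

variable {b : ℕ} {u : (Fin b → ℝ) → ℝ}

/-- The mean absolute increment of a periodic function. -/
def absIncrement (u : (Fin b → ℝ) → ℝ) (v : Fin b → ℝ) : ℝ :=
  ∫ θ, |u (θ + v) - u θ| ∂cubeMeasure b

lemma absIncrement_add_le (hc : Continuous u) (hp : LatticePeriodic u) (v w : Fin b → ℝ) :
    absIncrement u (v + w) ≤ absIncrement u v + absIncrement u w := by
  have hv : absIncrement u v = ∫ θ, |u (θ + w + v) - u (θ + w)| ∂cubeMeasure b := by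
    have : LatticePeriodic fun θ => |u (θ + v) - u θ| := fun m x => by
      simp only [hp m x, hp.comp_add v m x]
    exact (this.integral_add w).symm
  rw [hv, absIncrement, absIncrement, ← integral_add
    (Continuous.integrable_cube (by fun_prop)) (Continuous.integrable_cube (by fun_prop))]
  refine integral_mono (Continuous.integrable_cube (by fun_prop))
    (Continuous.integrable_cube (by fun_prop)) fun θ => ?_
  rw [show θ + (v + w) = θ + w + v by abel]
  exact abs_sub_le _ _ _

lemma absIncrement_nsmul_le (hc : Continuous u) (hp : LatticePeriodic u) (v : Fin b → ℝ) (j : ℕ) :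
    absIncrement u ((j : ℝ) • v) ≤ j * absIncrement u v := by
  induction j with
  | zero => simp [absIncrement]
  | succ j ih =>
    push_cast
    rw [add_smul, one_smul, add_one_mul]
    exact (absIncrement_add_le hc hp _ _).trans (by linarith)

lemma absIncrement_add_intVec (hp : LatticePeriodic u) (v : Fin b → ℝ) (m : Fin b → ℤ) :
    absIncrement u (v + intVec m) = absIncrement u v := by
  simp only [absIncrement, ← add_assoc, hp m _]

end AbsIncrement

section MeanLog

variable {b : ℕ} {f : (Fin b → ℝ) → ℝ} {lam E M : ℝ} {ω : Fin b → ℝ}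

lemma meanLog_nonneg (k : ℕ) (θ : Fin b → ℝ) : 0 ≤ meanLog f lam E ω k θ :=
  div_nonneg (logNorm_nonneg _ _) (Nat.cast_nonneg _)

lemma meanLog_le (hM : ∀ x, ‖E - lam * f x‖ ≤ M) {k : ℕ} (hk : 1 ≤ k) (θ : Fin b → ℝ) :
    meanLog f lam E ω k θ ≤ Real.log (M ^ 2 + 2) / 2 := by
  have hk' : (0 : ℝ) < k := by exact_mod_cast hk
  rw [meanLog, div_le_iff₀ hk', mul_comm]
  exact logNorm_le (fun n => hM _) hk

lemma continuous_meanLog_uncurry (hf : Continuous f) (k : ℕ) :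
    Continuous fun q : (Fin b → ℝ) × (Fin b → ℝ) => meanLog f lam E q.1 k q.2 := by
  unfold meanLog
  exact (continuous_logNorm
    (a := fun n (q : (Fin b → ℝ) × (Fin b → ℝ)) => E - lam * f (q.2 + (n : ℝ) • q.1))
    (fun n => by fun_prop) k).div_const _

lemma continuous_meanLog (hf : Continuous f) (k : ℕ) : Continuous (meanLog f lam E ω k) := by
  unfold meanLog
  exact (continuous_logNorm (a := fun n θ => E - lam * f (θ + (n : ℝ) • ω))
    (fun n => by fun_prop) k).div_const _

lemma latticePeriodic_meanLog (hp : LatticePeriodic f) (k : ℕ) :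
    LatticePeriodic (meanLog f lam E ω k) := by
  intro m x
  have : ∀ n : ℕ, f (x + intVec m + (n : ℝ) • ω) = f (x + (n : ℝ) • ω) := fun n =>
    hp.comp_add ((n : ℝ) • ω) m x
  simp only [meanLog, this]

lemma logNorm_orbit (θ : Fin b → ℝ) (l k : ℕ) :
    logNorm (fun n => E - lam * f (θ + (l : ℝ) • ω + (n : ℝ) • ω)) k =
      logNorm (fun n => E - lam * f (θ + ((l + n : ℕ) : ℝ) • ω)) k := by
  simp only [Nat.cast_add, add_smul, add_assoc]

lemma abs_meanLog_shift_sub_le (hM : ∀ x, ‖E - lam * f x‖ ≤ M) (k : ℕ) (l : ℤ) (θ : Fin b → ℝ) :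
    |meanLog f lam E ω k (θ + (l : ℝ) • ω) - meanLog f lam E ω k θ| ≤
      |(l : ℝ)| * Real.log (M ^ 2 + 2) / k := by
  have key : ∀ (n : ℕ) (θ : Fin b → ℝ),
      |meanLog f lam E ω k (θ + (n : ℝ) • ω) - meanLog f lam E ω k θ| ≤
        n * Real.log (M ^ 2 + 2) / k := by
    intro n θ
    have h := abs_logNorm_shift_sub_le_mul (a := fun n => E - lam * f (θ + (n : ℝ) • ω))
      (fun _ => hM _) k n
    rw [meanLog, meanLog, logNorm_orbit, ← sub_div, abs_div, Nat.abs_cast]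
    gcongr
    simp only [add_comm n]
    linarith
  obtain ⟨n, rfl | rfl⟩ := l.eq_nat_or_neg
  · simpa using key n θ
  · have := key n (θ + ((-(n : ℤ) : ℤ) : ℝ) • ω)
    rw [abs_sub_comm]
    simpa [add_assoc] using this

lemma absIncrement_meanLog_le_of_isAlmostReturn (hf : Continuous f) (hp : LatticePeriodic f)
    (hM : ∀ x, ‖E - lam * f x‖ ≤ M) {C : ℝ} (hC0 : 0 ≤ C)
    (hC : ∀ ω k, 1 ≤ k → ∀ v, absIncrement (meanLog f lam E ω k) v ≤ C * √‖v‖)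
    {K s k : ℕ} (hK : 1 ≤ K) (hk : K ≤ k) (h : IsAlmostReturn ω K s) :
    absIncrement (meanLog f lam E ω k) ((K : ℝ) • ω) ≤
      (Real.log (M ^ 2 + 2) + C) * (1 / 2) ^ s := by
  obtain ⟨l, hl, m, hm⟩ := h
  set u := meanLog f lam E ω k with hu
  have huc : Continuous u := continuous_meanLog hf k
  have hup : LatticePeriodic u := latticePeriodic_meanLog hp k
  set v := ((K : ℝ) - l) • ω - intVec m with hv
  have hlog : 0 ≤ Real.log (M ^ 2 + 2) := Real.log_nonneg (by nlinarith [sq_nonneg M])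
  have hk0 : (0 : ℝ) < k := by exact_mod_cast (by omega : 0 < k)
  have e : (K : ℝ) • ω = (v + (l : ℝ) • ω) + intVec m := by
    rw [hv, sub_smul]; abel
  rw [e, absIncrement_add_intVec hup]
  refine (absIncrement_add_le huc hup _ _).trans ?_
  have h1 : absIncrement u v ≤ C * (1 / 2) ^ s := by
    refine (hC ω k (hK.trans hk) v).trans ?_
    gcongr
    rw [Real.sqrt_le_left (by positivity), ← pow_mul, mul_comm, pow_mul]
    norm_num at hm ⊢
    exact hm
  have h2 : absIncrement u ((l : ℝ) • ω) ≤ Real.log (M ^ 2 + 2) * (1 / 2) ^ s := by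
    have h3 : absIncrement u ((l : ℝ) • ω) ≤
        ∫ _, |(l : ℝ)| * Real.log (M ^ 2 + 2) / k ∂cubeMeasure b :=
      integral_mono (Continuous.integrable_cube (by fun_prop)) (integrable_const _)
        fun θ => abs_meanLog_shift_sub_le hM k l θ
    rw [integral_const, probReal_univ, one_smul] at h3
    refine h3.trans ?_
    have h4 : |(l : ℝ)| * 2 ^ s ≤ k := by
      have : ((|l| * 2 ^ s : ℤ) : ℝ) ≤ ((K : ℤ) : ℝ) := by exact_mod_cast hl
      push_cast at this
      exact this.trans (by exact_mod_cast hk)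
    rw [one_div, inv_pow, ← div_eq_mul_inv, div_le_div_iff₀ hk0 (by positivity)]
    nlinarith
  linarith

end MeanLog

section Doubling

variable {b : ℕ} {f : (Fin b → ℝ) → ℝ} {lam E M : ℝ} {ω : Fin b → ℝ}

/-- The integrated form of `meanLog`, whose limit is the Lyapunov exponent. -/
def finiteLyapunov (f : (Fin b → ℝ) → ℝ) (lam E : ℝ) (ω : Fin b → ℝ) (k : ℕ) : ℝ :=
  ∫ θ, meanLog f lam E ω k θ ∂cubeMeasure b

/-- The mean of the excess over `2 κ` of the extrapolation `2 u_{2k} - u_k`. -/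
def meanExcess (f : (Fin b → ℝ) → ℝ) (lam E : ℝ) (ω : Fin b → ℝ) (κ : ℝ) (k : ℕ) : ℝ :=
  ∫ θ, max (2 * meanLog f lam E ω (2 * k) θ - meanLog f lam E ω k θ - 2 * κ) 0 ∂cubeMeasure b

lemma two_mul_meanLog_two_mul_le (k : ℕ) (θ : Fin b → ℝ) :
    2 * meanLog f lam E ω (2 * k) θ ≤
      meanLog f lam E ω k θ + meanLog f lam E ω k (θ + (k : ℝ) • ω) := by
  rcases k.eq_zero_or_pos with rfl | hk
  · simp [meanLog]
  have hk' : (0 : ℝ) < k := by exact_mod_cast hk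
  have h := logNorm_add_le (fun n => E - lam * f (θ + (n : ℝ) • ω)) k k
  rw [meanLog, meanLog, meanLog, logNorm_orbit, ← add_div, ← mul_div_assoc,
    div_le_div_iff₀ (by positivity) hk', two_mul k]
  push_cast at h ⊢
  nlinarith [mul_le_mul_of_nonneg_right h hk'.le]

/-- The increments of the `K`- and `2K`-step means along the first blocks of length `K`. -/
def blockIncrement (u w : (Fin b → ℝ) → ℝ) (ω : Fin b → ℝ) (K : ℕ) (θ : Fin b → ℝ) : ℝ :=
  |u (θ + (1 : ℕ) • (K : ℝ) • ω) - u θ| + |u (θ + (2 : ℕ) • (K : ℝ) • ω) - u θ| +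
    |u (θ + (3 : ℕ) • (K : ℝ) • ω) - u θ| + |w (θ + (1 : ℕ) • (K : ℝ) • ω) - w θ| +
    |w (θ + (2 : ℕ) • (K : ℝ) • ω) - w θ|

lemma logNorm_block (θ : Fin b → ℝ) (K j k : ℕ) (hk : 1 ≤ k) :
    (k : ℝ) * meanLog f lam E ω k (θ + j • (K : ℝ) • ω) =
      logNorm (fun n => E - lam * f (θ + ((j * K + n : ℕ) : ℝ) • ω)) k := by
  have hk' : (k : ℝ) ≠ 0 := by exact_mod_cast (by omega : k ≠ 0)
  rw [← logNorm_orbit, meanLog, mul_div_cancel₀ _ hk', ← Nat.cast_smul_eq_nsmul ℝ, smul_smul,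
    ← Nat.cast_mul]

lemma max_excess_le (hM : ∀ x, ‖E - lam * f x‖ ≤ M) {κ : ℝ} (hκ : 0 < κ) {K : ℕ} (hK : 1 ≤ K)
    (hKκ : 2 * Real.log 2 ≤ K * κ) (θ : Fin b → ℝ) :
    max (2 * meanLog f lam E ω (2 * K) θ - meanLog f lam E ω K θ - 2 * κ) 0 ≤
      max (2 * meanLog f lam E ω (2 * (2 * K)) θ - meanLog f lam E ω (2 * K) θ - 2 * κ) 0 +
        (Real.log 2 / K + (2 + 4 * Real.log (M ^ 2 + 2) / κ) *
          blockIncrement (meanLog f lam E ω K) (meanLog f lam E ω (2 * K)) ω K θ) := by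
  set u := meanLog f lam E ω K with hu
  set w := meanLog f lam E ω (2 * K) with hw
  set c := Real.log (M ^ 2 + 2) with hc
  set Δ := blockIncrement u w ω K θ with hΔ
  set L := Real.log 2 / K with hL
  have hK0 : (0 : ℝ) < K := by exact_mod_cast hK
  have hl2 : 0 ≤ Real.log 2 := Real.log_nonneg (by norm_num)
  have hL0 : 0 ≤ L := div_nonneg hl2 hK0.le
  have hKL : K * L = Real.log 2 := mul_div_cancel₀ _ hK0.ne'
  have hLκ : 2 * L ≤ κ := by
    rw [hL, ← mul_div_assoc, div_le_iff₀ hK0]; linarith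
  have hc0 : 0 ≤ c := Real.log_nonneg (by nlinarith [sq_nonneg M])
  have hΔ0 : 0 ≤ Δ := by rw [hΔ, blockIncrement]; positivity
  have hrhs : 0 ≤ L + (2 + 4 * c / κ) * Δ := by positivity
  rcases le_or_gt (2 * w θ - u θ) (2 * κ) with h0 | h0
  · rw [max_eq_right (by linarith)]
    exact add_nonneg (le_max_right _ _) hrhs
  rw [max_eq_left (by linarith)]
  rcases lt_or_ge (κ / 4) Δ with h1 | h1
  · have h2 : c ≤ 4 * c / κ * Δ := by
      rw [div_mul_eq_mul_div, le_div_iff₀ hκ]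
      nlinarith
    have h3 : w θ ≤ c / 2 := meanLog_le hM (by omega) θ
    have h4 : 0 ≤ u θ := meanLog_nonneg K θ
    have h5 := le_max_right (2 * meanLog f lam E ω (2 * (2 * K)) θ - w θ - 2 * κ) 0
    nlinarith
  have hblock := logNorm_four_blocks_le (fun n => E - lam * f (θ + (n : ℝ) • ω)) K
    (fun j => K * u (θ + j • (K : ℝ) • ω)) (fun j => (2 * K : ℕ) * w (θ + j • (K : ℝ) • ω))
    (fun j => logNorm_block θ K j K hK) (fun j => logNorm_block θ K j (2 * K) (by omega))
  have h4 : logNorm (fun n : ℕ => E - lam * f (θ + (n : ℝ) • ω)) (4 * K) =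
      4 * K * meanLog f lam E ω (2 * (2 * K)) θ := by
    rw [meanLog, ← mul_assoc]
    push_cast
    field_simp
  rw [h4] at hblock
  simp only [zero_smul, add_zero] at hblock
  push_cast at hblock
  set a₁ := u (θ + (1 : ℕ) • (K : ℝ) • ω)
  set a₂ := u (θ + (2 : ℕ) • (K : ℝ) • ω)
  set a₃ := u (θ + (3 : ℕ) • (K : ℝ) • ω)
  set b₁ := w (θ + (1 : ℕ) • (K : ℝ) • ω)
  set b₂ := w (θ + (2 : ℕ) • (K : ℝ) • ω)
  have hΔ' : Δ = |a₁ - u θ| + |a₂ - u θ| + |a₃ - u θ| + |b₁ - w θ| + |b₂ - w θ| := rfl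
  have A1 := abs_le.1 (le_refl |a₁ - u θ|)
  have A2 := abs_le.1 (le_refl |a₂ - u θ|)
  have A3 := abs_le.1 (le_refl |a₃ - u θ|)
  have B1 := abs_le.1 (le_refl |b₁ - w θ|)
  have B2 := abs_le.1 (le_refl |b₂ - w θ|)
  have N1 := abs_nonneg (a₁ - u θ)
  have N2 := abs_nonneg (a₂ - u θ)
  have N3 := abs_nonneg (a₃ - u θ)
  have P1 := abs_nonneg (b₁ - w θ)
  have P2 := abs_nonneg (b₂ - w θ)
  have g1 : 0 ≤ K * (2 * b₂ + 2 * b₁ - a₃ - a₁ - L) := mul_nonneg hK0.le (by linarith)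
  have g2 : 0 ≤ K * (2 * b₁ + 2 * w θ - a₂ - u θ - 2 * L) := mul_nonneg hK0.le (by linarith)
  have hres := hblock (by linarith) (by linarith)
  have h5 : 0 ≤ K * (4 * meanLog f lam E ω (2 * (2 * K)) θ -
      (2 * b₂ + 2 * b₁ + 2 * w θ - a₂ - a₁ - 2 * L)) := by linarith
  have h6 := (mul_nonneg_iff_of_pos_left hK0).1 h5
  have h7 := le_max_left (2 * meanLog f lam E ω (2 * (2 * K)) θ - w θ - 2 * κ) 0
  have h8 : 0 ≤ 4 * c / κ * Δ := by positivity
  linarith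

lemma integral_blockIncrement_le {u w : (Fin b → ℝ) → ℝ} (hu : Continuous u)
    (hup : LatticePeriodic u) (hw : Continuous w) (hwp : LatticePeriodic w) {K : ℕ} {D : ℝ}
    (hDu : absIncrement u ((K : ℝ) • ω) ≤ D) (hDw : absIncrement w ((K : ℝ) • ω) ≤ D) :
    ∫ θ, blockIncrement u w ω K θ ∂cubeMeasure b ≤ 9 * D := by
  have h : ∫ θ, blockIncrement u w ω K θ ∂cubeMeasure b =
      absIncrement u ((1 : ℕ) • (K : ℝ) • ω) + absIncrement u ((2 : ℕ) • (K : ℝ) • ω) +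
      absIncrement u ((3 : ℕ) • (K : ℝ) • ω) + absIncrement w ((1 : ℕ) • (K : ℝ) • ω) +
      absIncrement w ((2 : ℕ) • (K : ℝ) • ω) := by
    unfold blockIncrement absIncrement
    rw [integral_add, integral_add, integral_add, integral_add] <;>
      exact Continuous.integrable_cube (by fun_prop)
  have hmul : ∀ {g : (Fin b → ℝ) → ℝ}, Continuous g → LatticePeriodic g →
      absIncrement g ((K : ℝ) • ω) ≤ D → ∀ j : ℕ, absIncrement g (j • (K : ℝ) • ω) ≤ j * D := by
    intro g hg hgp hD j
    rw [← Nat.cast_smul_eq_nsmul ℝ]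
    exact (absIncrement_nsmul_le hg hgp _ j).trans (by gcongr)
  have h1 := hmul hu hup hDu 1
  have h2 := hmul hu hup hDu 2
  have h3 := hmul hu hup hDu 3
  have h4 := hmul hw hwp hDw 1
  have h5 := hmul hw hwp hDw 2
  rw [h]
  push_cast at h1 h2 h3 h4 h5
  linarith

lemma meanExcess_le (hf : Continuous f) (hp : LatticePeriodic f)
    (hM : ∀ x, ‖E - lam * f x‖ ≤ M) {C : ℝ} (hC0 : 0 ≤ C)
    (hC : ∀ ω k, 1 ≤ k → ∀ v, absIncrement (meanLog f lam E ω k) v ≤ C * √‖v‖)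
    {κ : ℝ} (hκ : 0 < κ) {K s : ℕ} (hK : 1 ≤ K) (hKκ : 2 * Real.log 2 ≤ K * κ)
    (h : IsAlmostReturn ω K s) :
    meanExcess f lam E ω κ K ≤ meanExcess f lam E ω κ (2 * K) + Real.log 2 / K +
      9 * (2 + 4 * Real.log (M ^ 2 + 2) / κ) * (Real.log (M ^ 2 + 2) + C) * (1 / 2) ^ s := by
  have hcont : ∀ k, Continuous (meanLog f lam E ω k) := fun k => continuous_meanLog hf k
  have hper : ∀ k, LatticePeriodic (meanLog f lam E ω k) := fun k => latticePeriodic_meanLog hp k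
  have hb := integral_blockIncrement_le (hcont K) (hper K) (hcont (2 * K)) (hper (2 * K))
    (absIncrement_meanLog_le_of_isAlmostReturn hf hp hM hC0 hC hK le_rfl h)
    (absIncrement_meanLog_le_of_isAlmostReturn hf hp hM hC0 hC hK (by omega : K ≤ 2 * K) h)
  have hc0 : 0 ≤ Real.log (M ^ 2 + 2) := Real.log_nonneg (by nlinarith [sq_nonneg M])
  have hbc : Continuous
      (blockIncrement (meanLog f lam E ω K) (meanLog f lam E ω (2 * K)) ω K) := by
    unfold blockIncrement; fun_prop
  set A := 2 + 4 * Real.log (M ^ 2 + 2) / κ with hA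
  have hA0 : 0 ≤ A := by positivity
  have h1 : meanExcess f lam E ω κ K ≤ ∫ θ,
      (max (2 * meanLog f lam E ω (2 * (2 * K)) θ - meanLog f lam E ω (2 * K) θ - 2 * κ) 0 +
        (Real.log 2 / K + A *
          blockIncrement (meanLog f lam E ω K) (meanLog f lam E ω (2 * K)) ω K θ))
        ∂cubeMeasure b :=
    integral_mono (Continuous.integrable_cube (by fun_prop))
      (Continuous.integrable_cube (by fun_prop)) fun θ => max_excess_le hM hκ hK hKκ θ
  rw [integral_add (Continuous.integrable_cube (by fun_prop))
    (Continuous.integrable_cube (by fun_prop)), integral_add (integrable_const _)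
    (Continuous.integrable_cube (by fun_prop)), integral_const, probReal_univ, one_smul,
    integral_const_mul] at h1
  have h2 := mul_le_mul_of_nonneg_left hb hA0
  unfold meanExcess at h1 ⊢
  linarith

lemma meanExcess_le_finiteLyapunov (hf : Continuous f) (hp : LatticePeriodic f) {κ : ℝ}
    (hκ : 0 ≤ κ) (k : ℕ) : meanExcess f lam E ω κ k ≤ finiteLyapunov f lam E ω k := by
  have hcont : ∀ k, Continuous (meanLog f lam E ω k) := fun k => continuous_meanLog hf k
  have h := (latticePeriodic_meanLog (lam := lam) (E := E) (ω := ω) hp k).integral_add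
    ((k : ℝ) • ω)
  rw [finiteLyapunov, ← h]
  refine integral_mono (Continuous.integrable_cube (by fun_prop))
    (Continuous.integrable_cube (by fun_prop)) fun θ => max_le ?_ (meanLog_nonneg k _)
  have := two_mul_meanLog_two_mul_le (f := f) (lam := lam) (E := E) (ω := ω) k θ
  linarith

lemma two_mul_finiteLyapunov_sub_le (hf : Continuous f) (κ : ℝ) (k : ℕ) :
    2 * finiteLyapunov f lam E ω (2 * k) - finiteLyapunov f lam E ω k - 2 * κ ≤
      meanExcess f lam E ω κ k := by
  have hcont : ∀ k, Continuous (meanLog f lam E ω k) := fun k => continuous_meanLog hf k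
  have h : 2 * finiteLyapunov f lam E ω (2 * k) - finiteLyapunov f lam E ω k - 2 * κ =
      ∫ θ, (2 * meanLog f lam E ω (2 * k) θ - meanLog f lam E ω k θ - 2 * κ) ∂cubeMeasure b := by
    rw [integral_sub (Continuous.integrable_cube (by fun_prop)) (integrable_const _),
      integral_sub (Continuous.integrable_cube (by fun_prop))
      (Continuous.integrable_cube (by fun_prop)), integral_const_mul, integral_const,
      probReal_univ, one_smul]
    rfl
  rw [h]
  exact integral_mono (Continuous.integrable_cube (by fun_prop))
    (Continuous.integrable_cube (by fun_prop)) fun θ => le_max_left _ _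

lemma finiteLyapunov_two_mul_le (hf : Continuous f) (hp : LatticePeriodic f) (k : ℕ) :
    finiteLyapunov f lam E ω (2 * k) ≤ finiteLyapunov f lam E ω k := by
  have h1 := two_mul_finiteLyapunov_sub_le (lam := lam) (E := E) (ω := ω) hf 0 k
  have h2 := meanExcess_le_finiteLyapunov (lam := lam) (E := E) (ω := ω) hf hp le_rfl k
  linarith

lemma finiteLyapunov_two_pow_mul_le (hf : Continuous f) (hp : LatticePeriodic f) (k n : ℕ) :
    finiteLyapunov f lam E ω (2 ^ n * k) ≤ finiteLyapunov f lam E ω k := by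
  induction n with
  | zero => simp
  | succ n ih =>
    rw [pow_succ', mul_assoc]
    exact (finiteLyapunov_two_mul_le hf hp _).trans ih

lemma finiteLyapunov_extrapolation_le (hf : Continuous f) (hp : LatticePeriodic f)
    (hM : ∀ x, ‖E - lam * f x‖ ≤ M) {C : ℝ} (hC0 : 0 ≤ C)
    (hC : ∀ ω k, 1 ≤ k → ∀ v, absIncrement (meanLog f lam E ω k) v ≤ C * √‖v‖)
    {κ : ℝ} (hκ : 0 < κ) {k : ℕ} (hk : 1 ≤ k) (hkκ : 2 * Real.log 2 ≤ k * κ) (σ : ℕ → ℕ)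
    (h : ∀ i, IsAlmostReturn ω (2 ^ i * k) (σ i)) (n : ℕ) :
    2 * finiteLyapunov f lam E ω (2 * k) - finiteLyapunov f lam E ω k - 2 * κ ≤
      finiteLyapunov f lam E ω (2 ^ n * k) + κ +
        9 * (2 + 4 * Real.log (M ^ 2 + 2) / κ) * (Real.log (M ^ 2 + 2) + C) *
          ∑ i ∈ Finset.range n, (1 / 2 : ℝ) ^ σ i := by
  set A := 9 * (2 + 4 * Real.log (M ^ 2 + 2) / κ) * (Real.log (M ^ 2 + 2) + C) with hA
  have hk0 : (0 : ℝ) < k := by exact_mod_cast hk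
  have hl2 : 0 ≤ Real.log 2 := Real.log_nonneg (by norm_num)
  have key : meanExcess f lam E ω κ k ≤ meanExcess f lam E ω κ (2 ^ n * k) +
      2 * (1 - (1 / 2) ^ n) * (Real.log 2 / k) +
      A * ∑ i ∈ Finset.range n, (1 / 2 : ℝ) ^ σ i := by
    induction n with
    | zero => simp
    | succ n ih =>
      have hpow : 1 ≤ 2 ^ n * k := Nat.mul_pos (by positivity) hk
      have hκn : 2 * Real.log 2 ≤ (2 ^ n * k : ℕ) * κ := by
        refine hkκ.trans (mul_le_mul_of_nonneg_right ?_ hκ.le)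
        exact_mod_cast Nat.le_mul_of_pos_left k (by positivity)
      have h1 := meanExcess_le hf hp hM hC0 hC hκ hpow hκn (h n)
      rw [← hA] at h1
      have h2 : Real.log 2 / ((2 ^ n * k : ℕ) : ℝ) = (1 / 2) ^ n * (Real.log 2 / k) := by
        push_cast
        rw [one_div, inv_pow]
        field_simp
      rw [Finset.sum_range_succ, pow_succ' 2 n, mul_assoc 2, pow_succ]
      rw [h2] at h1
      linarith
  have h3 : 2 * (1 - (1 / 2) ^ n) * (Real.log 2 / k) ≤ κ := by
    have h4 : 2 * (Real.log 2 / k) ≤ κ := by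
      rw [← mul_div_assoc, div_le_iff₀ hk0]; linarith
    have h5 : 0 ≤ (1 / 2 : ℝ) ^ n * (Real.log 2 / k) := by positivity
    linarith
  have h6 := two_mul_finiteLyapunov_sub_le (lam := lam) (E := E) (ω := ω) hf κ k
  have h7 := meanExcess_le_finiteLyapunov (lam := lam) (E := E) (ω := ω) hf hp hκ.le (2 ^ n * k)
  linarith

end Doubling

section Kronecker

open UnitAddTorus

variable {b : ℕ}

lemma mFourier_coe_ne_one {ω : Fin b → ℝ} (hω : Incommensurate b ω) {n : Fin b → ℤ} (hn : n ≠ 0) :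
    mFourier n (fun i => (ω i : UnitAddCircle)) ≠ 1 := by
  intro h
  have h1 : mFourier n (fun i => (ω i : UnitAddCircle)) =
      Complex.exp (2 * Real.pi * Complex.I * ((∑ i, (n i : ℝ) * ω i : ℝ) : ℂ)) := by
    simp only [mFourier, ContinuousMap.coe_mk, fourier_coe_apply]
    rw [← Complex.exp_sum]
    push_cast
    rw [Finset.mul_sum]
    congr 1
    refine Finset.sum_congr rfl fun i _ => ?_
    rw [div_one, mul_assoc]
  rw [h1, Complex.exp_eq_one_iff] at h
  obtain ⟨m, hm⟩ := h
  refine hω n hn m ?_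
  have h2 : (2 * Real.pi * Complex.I : ℂ) ≠ 0 := Complex.two_pi_I_ne_zero
  rw [mul_comm (m : ℂ)] at hm
  exact_mod_cast mul_left_cancel₀ h2 hm

/-- The Birkhoff averages of every continuous function along the rotation converge to its mean. -/
lemma tendsto_average_rotation {α : UnitAddTorus (Fin b)}
    (hα : ∀ n : Fin b → ℤ, n ≠ 0 → mFourier n α ≠ 1) (x : UnitAddTorus (Fin b))
    (g : C(UnitAddTorus (Fin b), ℂ)) :
    Tendsto (fun N : ℕ => (N : ℂ)⁻¹ * ∑ l ∈ Finset.range N, g (x + l • α)) atTop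
      (nhds (∫ y, g y)) := by
  have : IsProbabilityMeasure (volume : Measure UnitAddCircle) := ⟨UnitAddCircle.measure_univ⟩
  have hadd : ∀ (n : Fin b → ℤ) (y z : UnitAddTorus (Fin b)),
      mFourier n (y + z) = mFourier n y * mFourier n z := by
    intro n y z
    simp [mFourier, ← Finset.prod_mul_distrib, fourier_apply, AddCircle.toCircle_add]
  have hfour : ∀ n : Fin b → ℤ, Tendsto
      (fun N : ℕ => (N : ℂ)⁻¹ * ∑ l ∈ Finset.range N, mFourier n (x + l • α)) atTop
      (nhds (∫ y, mFourier n y)) := by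
    intro n
    rcases eq_or_ne n 0 with rfl | hn
    · simp only [mFourier_zero, ContinuousMap.one_apply, Finset.sum_const, Finset.card_range,
        nsmul_eq_mul, mul_one, integral_const, probReal_univ, one_smul]
      refine tendsto_const_nhds.congr' ?_
      filter_upwards [eventually_ne_atTop 0] with N hN
      rw [inv_mul_cancel₀ (by exact_mod_cast hN)]
    set c := mFourier n α with hc
    have hc1 : c - 1 ≠ 0 := sub_ne_zero.2 (hα n hn)
    have hcn : ‖c‖ ≤ 1 := (ContinuousMap.norm_coe_le_norm _ α).trans mFourier_norm.le
    have hmean : ∫ y, mFourier n y = 0 := by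
      have h := integral_add_right_eq_self (μ := (volume : Measure (UnitAddTorus (Fin b))))
        (fun y => mFourier n y) α
      simp only [hadd, ← hc] at h
      rw [integral_mul_const] at h
      have : (∫ y, mFourier n y) * (c - 1) = 0 := by linear_combination h
      exact (mul_eq_zero.1 this).resolve_right hc1
    have horb : ∀ l : ℕ, mFourier n (x + l • α) = mFourier n x * c ^ l := by
      intro l
      induction l with
      | zero => simp
      | succ l ih => rw [succ_nsmul, ← add_assoc, hadd, ih, pow_succ, mul_assoc]
    rw [hmean]
    refine squeeze_zero_norm (a := fun N : ℕ => (N : ℝ)⁻¹ * (2 / ‖c - 1‖)) (fun N => ?_) ?_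
    · rw [norm_mul, norm_inv, Complex.norm_natCast]
      refine mul_le_mul_of_nonneg_left ?_ (by positivity)
      simp only [horb]
      rw [← Finset.mul_sum, geom_sum_eq (sub_ne_zero.1 hc1), norm_mul, norm_div]
      have h1 : ‖mFourier n x‖ ≤ 1 := (ContinuousMap.norm_coe_le_norm _ x).trans mFourier_norm.le
      have h2 : ‖c ^ N - 1‖ ≤ 2 := by
        refine (norm_sub_le _ _).trans ?_
        rw [norm_pow, norm_one]
        linarith [pow_le_one₀ (n := N) (norm_nonneg c) hcn]
      have h3 : ‖c ^ N - 1‖ / ‖c - 1‖ ≤ 2 / ‖c - 1‖ := by gcongr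
      have h4 : 0 ≤ ‖c ^ N - 1‖ / ‖c - 1‖ := by positivity
      nlinarith [norm_nonneg (mFourier n x)]
    · simpa using tendsto_inv_atTop_nhds_zero_nat.mul_const (2 / ‖c - 1‖)
  have hspan : ∀ h ∈ Submodule.span ℂ (Set.range (mFourier (d := Fin b))), Tendsto
      (fun N : ℕ => (N : ℂ)⁻¹ * ∑ l ∈ Finset.range N, h (x + l • α)) atTop
      (nhds (∫ y, h y)) := by
    intro h hh
    induction hh using Submodule.span_induction with
    | mem h hh => obtain ⟨n, rfl⟩ := hh; exact hfour n
    | zero => simp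
    | add h k _ _ h1 h2 =>
      simp only [ContinuousMap.add_apply, Finset.sum_add_distrib, mul_add]
      rw [integral_add (h.continuous.integrable_of_hasCompactSupport (.of_compactSpace _))
        (k.continuous.integrable_of_hasCompactSupport (.of_compactSpace _))]
      exact h1.add h2
    | smul a h _ h1 =>
      simp only [ContinuousMap.smul_apply, smul_eq_mul, ← Finset.mul_sum, integral_const_mul,
        mul_left_comm _ a]
      exact h1.const_mul a
  have hmem : g ∈ closure (Submodule.span ℂ (Set.range (mFourier (d := Fin b))) : Set _) := by
    rw [← Submodule.topologicalClosure_coe, span_mFourier_closure_eq_top]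
    trivial
  rw [Metric.tendsto_atTop]
  intro ε hε
  obtain ⟨h, hh, hgh⟩ := Metric.mem_closure_iff.1 hmem (ε / 3) (by positivity)
  obtain ⟨N₀, hN₀⟩ := Metric.tendsto_atTop.1 (hspan h hh) (ε / 3) (by positivity)
  refine ⟨N₀, fun N hN => ?_⟩
  have hpt : ∀ y, ‖g y - h y‖ ≤ ε / 3 := fun y => by
    rw [← dist_eq_norm]; exact (ContinuousMap.dist_apply_le_dist y).trans hgh.le
  have h1 : dist ((N : ℂ)⁻¹ * ∑ l ∈ Finset.range N, g (x + l • α))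
      ((N : ℂ)⁻¹ * ∑ l ∈ Finset.range N, h (x + l • α)) ≤ ε / 3 := by
    rw [dist_eq_norm, ← mul_sub, ← Finset.sum_sub_distrib, norm_mul, norm_inv,
      Complex.norm_natCast]
    have h2 := norm_sum_le_of_le (Finset.range N) fun l _ => hpt (x + l • α)
    rw [Finset.sum_const, Finset.card_range, nsmul_eq_mul] at h2
    rcases N.eq_zero_or_pos with rfl | hN'
    · simp; positivity
    have hN0 : (0 : ℝ) < N := by exact_mod_cast hN'
    rw [inv_mul_le_iff₀ hN0]
    exact h2
  have h2 : dist (∫ y, h y) (∫ y, g y) ≤ ε / 3 := by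
    rw [dist_comm, dist_eq_norm, ← integral_sub
      (g.continuous.integrable_of_hasCompactSupport (.of_compactSpace _))
      (h.continuous.integrable_of_hasCompactSupport (.of_compactSpace _))]
    simpa using norm_integral_le_of_norm_le_const (μ := volume) (.of_forall hpt)
  have h3 := hN₀ N hN
  linarith [dist_triangle4 ((N : ℂ)⁻¹ * ∑ l ∈ Finset.range N, g (x + l • α))
    ((N : ℂ)⁻¹ * ∑ l ∈ Finset.range N, h (x + l • α)) (∫ y, h y) (∫ y, g y)]

lemma exists_norm_add_nsmul_lt {α : UnitAddTorus (Fin b)}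
    (hα : ∀ n : Fin b → ℤ, n ≠ 0 → mFourier n α ≠ 1) {r : ℝ} (hr : 0 < r)
    (x : UnitAddTorus (Fin b)) : ∃ l : ℕ, ‖x + l • α‖ < r := by
  by_contra! h
  set φ : UnitAddTorus (Fin b) → ℝ := fun y => max (r - ‖y‖) 0 with hφ
  have hφc : Continuous φ := by fun_prop
  have hlim := tendsto_average_rotation hα x ⟨fun y => (φ y : ℂ), by fun_prop⟩
  have hzero : ∀ l : ℕ, φ (x + l • α) = 0 := fun l => max_eq_right (by linarith [h l])
  simp only [ContinuousMap.coe_mk, hzero, Complex.ofReal_zero, Finset.sum_const_zero,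
    mul_zero] at hlim
  have hmean := tendsto_nhds_unique tendsto_const_nhds hlim
  rw [integral_complex_ofReal] at hmean
  have hpos : 0 < ∫ y, φ y := hφc.integral_pos_of_hasCompactSupport_nonneg_nonzero
    (.of_compactSpace _) (fun y => le_max_right _ _) (x := 0) (by simp [hφ, hr.ne', hr.le])
  exact hpos.ne (by exact_mod_cast hmean)

lemma Incommensurate.exists_uniform_approx {ω : Fin b → ℝ} (hω : Incommensurate b ω) {r : ℝ}
    (hr : 0 < r) : ∃ T : ℕ, ∀ x : Fin b → ℝ, ∃ l ≤ T, ∃ m : Fin b → ℤ,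
      ‖x + (l : ℝ) • ω - intVec m‖ < r := by
  set α : UnitAddTorus (Fin b) := fun i => (ω i : UnitAddCircle) with hαdef
  have hα : ∀ n : Fin b → ℤ, n ≠ 0 → mFourier n α ≠ 1 := fun n hn => mFourier_coe_ne_one hω hn
  obtain ⟨t, ht⟩ := isCompact_univ.elim_finite_subcover
    (fun l : ℕ => {x : UnitAddTorus (Fin b) | ‖x + l • α‖ < r})
    (fun l => isOpen_lt (by fun_prop) continuous_const)
    (fun x _ => Set.mem_iUnion.2 (exists_norm_add_nsmul_lt hα hr x))
  refine ⟨t.sup id, fun x => ?_⟩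
  have hx := ht (Set.mem_univ fun i => (x i : UnitAddCircle))
  simp only [Set.mem_iUnion, Set.mem_ofPred_eq] at hx
  obtain ⟨l, hl, hxl⟩ := hx
  refine ⟨l, Finset.le_sup (f := id) hl, fun i => round (x i + l * ω i), ?_⟩
  rw [pi_norm_lt_iff hr] at hxl ⊢
  intro i
  have h := hxl i
  have e : ((fun i => (x i : UnitAddCircle)) + l • α) i = ((x i + l * ω i : ℝ) : UnitAddCircle) := by
    simp [hαdef, ← nsmul_eq_mul]
  rw [e, UnitAddCircle.norm_eq] at h
  simpa [intVec] using h

end Kronecker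

section Continuity

variable {b : ℕ} {f : (Fin b → ℝ) → ℝ} {lam E : ℝ}

lemma continuous_finiteLyapunov (hf : Continuous f) (k : ℕ) :
    Continuous fun ω => finiteLyapunov f lam E ω k :=
  continuous_integral_cube (continuous_meanLog_uncurry hf k)

lemma HasLyapunov.tendsto_finiteLyapunov {ω : Fin b → ℝ} {g : ℝ}
    (h : HasLyapunov b f lam E ω g) :
    Tendsto (fun k => finiteLyapunov f lam E ω k) atTop (nhds g) := by
  refine Tendsto.congr (fun k => ?_) h
  simp only [log_matNorm_transfer, finiteLyapunov, meanLog, cubeMeasure]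
  rw [integral_div, one_div, inv_mul_eq_div]

lemma isAlmostReturn_of_approx {ω ω₀ : Fin b → ℝ} {s T K : ℕ}
    (hT : ∀ x : Fin b → ℝ, ∃ l ≤ T, ∃ m : Fin b → ℤ,
      ‖x + (l : ℝ) • ω₀ - intVec m‖ < (1 / 4) ^ s / 2)
    (hω : T * ‖ω - ω₀‖ ≤ (1 / 4) ^ s / 2) (hK : T * 2 ^ s ≤ K) : IsAlmostReturn ω K s := by
  obtain ⟨l, hl, m, hm⟩ := hT (-((K : ℝ) • ω))
  refine ⟨l, ?_, -m, ?_⟩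
  · rw [Nat.abs_cast]
    exact_mod_cast (Nat.mul_le_mul_right _ hl).trans hK
  · have e : ((K : ℝ) - ((l : ℤ) : ℝ)) • ω - intVec (-m) =
        -(-((K : ℝ) • ω) + (l : ℝ) • ω₀ - intVec m) - (l : ℝ) • (ω - ω₀) := by
      rw [intVec_neg, Int.cast_natCast, sub_smul, smul_sub]
      abel
    rw [e]
    refine (norm_sub_le _ _).trans ?_
    rw [norm_neg, norm_smul, Real.norm_natCast]
    have h1 : (l : ℝ) * ‖ω - ω₀‖ ≤ T * ‖ω - ω₀‖ := by gcongr
    linarith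

end Continuity

/-- **Bourgain**: for a nonconstant real analytic `f` on `𝕋^b` and fixed `λ, E`, the Lyapunov
exponent `ω ↦ γ(E,ω)` of the quasiperiodic Schrödinger cocycle is continuous at every
incommensurate `ω`. -/
theorem lyapunov_continuous_at_incommensurate
    (b : ℕ) (hb : 1 ≤ b) (f : (Fin b → ℝ) → ℝ)
    (hf_an : ∀ x, AnalyticAt ℝ f x)
    (hf_per : ∀ (m : Fin b → ℤ) (x : Fin b → ℝ), f (x + fun i => (m i : ℝ)) = f x)
    (hf_nonconst : ∃ x y, f x ≠ f y)
    (lam E : ℝ) (γ : (Fin b → ℝ) → ℝ)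
    (hγ : ∀ ω : Fin b → ℝ, HasLyapunov b f lam E ω (γ ω))
    (ω : Fin b → ℝ) (hω : Incommensurate b ω) :
    ContinuousAt γ ω := by
  have hf : Continuous f := continuous_of_analyticAt hf_an
  have hp : LatticePeriodic f := hf_per
  have hlim := fun ω => (hγ ω).tendsto_finiteLyapunov
  obtain ⟨M, hM⟩ : ∃ M, ∀ x, ‖E - lam * f x‖ ≤ M :=
    (hp.comp fun y => E - lam * y).exists_norm_le (by fun_prop)
  obtain ⟨C, hC0, hC⟩ := exists_integral_abs_meanLog_sub_le hf_an hp lam E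
  rw [Metric.continuousAt_iff']
  intro ε hε
  set κ := ε / 20 with hκε
  have hκ : 0 < κ := by positivity
  set A := 9 * (2 + 4 * Real.log (M ^ 2 + 2) / κ) * (Real.log (M ^ 2 + 2) + C) with hA
  have hlog : 0 ≤ Real.log (M ^ 2 + 2) := Real.log_nonneg (by nlinarith [sq_nonneg M])
  have hA0 : 0 ≤ A := by positivity
  obtain ⟨s, hs⟩ := exists_scales_sum_le b (ε := κ / (A + 1)) (by positivity)
  obtain ⟨T, hT⟩ := hω.exists_uniform_approx (r := (1 / 4) ^ s / 2) (by positivity)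
  have hlarge : ∀ᶠ k : ℕ in atTop, 2 * Real.log 2 ≤ k * κ := by
    filter_upwards [eventually_ge_atTop ⌈2 * Real.log 2 / κ⌉₊] with k hk
    rw [← div_le_iff₀ hκ]
    exact Nat.ceil_le.1 hk
  have hnear : ∀ᶠ k in atTop, |finiteLyapunov f lam E ω k - γ ω| < κ := by
    simpa only [Real.dist_eq] using (Metric.tendsto_nhds.1 (hlim ω)) κ hκ
  obtain ⟨k, hk1, hkT, hkκ, hkG, hkG2⟩ := ((eventually_ge_atTop 1).and
    ((eventually_ge_atTop (T * 2 ^ s)).and (hlarge.and (hnear.and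
      ((tendsto_id.const_mul_atTop' (by norm_num : 0 < 2)).eventually hnear))))).exists
  have hcont := fun k => (continuous_finiteLyapunov (lam := lam) (E := E) hf k).continuousAt (x := ω)
  have hωT : ∀ᶠ ω' in nhds ω, (T : ℝ) * ‖ω' - ω‖ < (1 / 4) ^ s / 2 := by
    have h : ContinuousAt (fun ω' => (T : ℝ) * ‖ω' - ω‖) ω := by fun_prop
    exact h.eventually_lt_const (by simp)
  filter_upwards [hωT, Metric.continuousAt_iff'.1 (hcont k) κ hκ,
    Metric.continuousAt_iff'.1 (hcont (2 * k)) κ hκ] with ω' h1 h2 h3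
  rw [Real.dist_eq] at h2 h3 ⊢
  have hret : ∀ i, IsAlmostReturn ω' (2 ^ i * k) s := fun i =>
    isAlmostReturn_of_approx hT h1.le (hkT.trans (Nat.le_mul_of_pos_left k (by positivity)))
  have hsub : Tendsto (fun n => finiteLyapunov f lam E ω' (2 ^ n * k)) atTop (nhds (γ ω')) :=
    (hlim ω').comp ((tendsto_pow_atTop_atTop_of_one_lt (by norm_num)).atTop_mul_const' hk1)
  have hupper : γ ω' ≤ finiteLyapunov f lam E ω' k :=
    le_of_tendsto' hsub fun n => finiteLyapunov_two_pow_mul_le hf hp k n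
  have hlower : 2 * finiteLyapunov f lam E ω' (2 * k) - finiteLyapunov f lam E ω' k - 4 * κ ≤
      γ ω' := by
    refine ge_of_tendsto' hsub fun n => ?_
    obtain ⟨σ, hσ, hsum⟩ := hs ω' k hret n
    have h4 := finiteLyapunov_extrapolation_le hf hp hM hC0 hC hκ hk1 hkκ σ hσ n
    have h5 : A * ∑ i ∈ Finset.range n, (1 / 2 : ℝ) ^ σ i ≤ κ := by
      refine (mul_le_mul_of_nonneg_left hsum hA0).trans ?_
      rw [← mul_div_assoc, div_le_iff₀ (by positivity)]
      nlinarith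
    linarith
  simp only [id] at hkG2
  rw [abs_lt] at h2 h3 hkG hkG2 ⊢
  constructor <;> linarith
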